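/- arXiv:2207.07946 — 2 statements merged into one kernel-verified Lean document; each statement's English description precedes it below -/
import Mathlib

section
/- Let d ≥ n−1 be an integer. Then the rank of the d-th order blow-up A^{(d)} of the matrix representation A equals 2d times the maximum cardinality of a fractional matroid matching: rank A^{(d)} = 2d · max_{y ∈ P} |y|. (Equivalently, the non-commutative rank of A equals twice the maximum cardinality of a fractional matroid matching.) -/
open Matrix

noncomputable section

/-- Wedge product `a ∧ b = a bᵀ − b aᵀ`. -/
def wedge {K : Type*} [Field K] {n : ℕ} (a b : Fin n → K) : Matrix (Fin n) (Fin n) K :=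
  vecMulVec a b - vecMulVec b a

/-- The line spanned by `a` and `b`. -/
def line {K : Type*} [Field K] {n : ℕ} (a b : Fin n → K) : Submodule K (Fin n → K) :=
  Submodule.span K {a, b}

/-- `y` is a fractional matroid matching for the lines `ℓᵢ = span {aᵢ, bᵢ}`:
`y ≥ 0` and `∑ᵢ dim(S ⊓ ℓᵢ) yᵢ ≤ dim S` for every subspace `S`. -/
def IsFracMatching {K : Type*} [Field K] {n m : ℕ} (a b : Fin m → Fin n → K)
    (y : Fin m → ℝ) : Prop :=
  (∀ i, 0 ≤ y i) ∧ ∀ S : Submodule K (Fin n → K),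
    ∑ i, (Module.finrank K ↥(S ⊓ line (a i) (b i)) : ℝ) * y i ≤ (Module.finrank K ↥S : ℝ)

/-- The rational function field generated over `K` by the entries of the `d × d`
indeterminate matrices `X₁, …, X_m`. -/
abbrev FF (K : Type*) [Field K] (m d : ℕ) : Type _ :=
  FractionRing (MvPolynomial (Fin m × Fin d × Fin d) K)

def toFF (K : Type*) [Field K] (m d : ℕ) : K →+* FF K m d :=
  (algebraMap (MvPolynomial (Fin m × Fin d × Fin d) K) (FF K m d)).comp MvPolynomial.C

/-- The `d`-th order blow-up `A^{(d)} = ∑ᵢ Xᵢ ⊗ (aᵢ ∧ bᵢ)` of the matrix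
representation `A = ∑ᵢ xᵢ (aᵢ ∧ bᵢ)`. -/
def blowup {K : Type*} [Field K] {n m : ℕ} (a b : Fin m → Fin n → K) (d : ℕ) :
    Matrix (Fin d × Fin n) (Fin d × Fin n) (FF K m d) :=
  ∑ i : Fin m,
    kroneckerMap (· * ·)
      (Matrix.of fun p q : Fin d =>
        algebraMap (MvPolynomial (Fin m × Fin d × Fin d) K) (FF K m d) (MvPolynomial.X (i, p, q)))
      ((wedge (a i) (b i)).map (toFF K m d))

section GPI

variable {K D : Type*} [Field K] [DivisionRing D] [Algebra K D]

/-- Every central element of `D` is a scalar from `K`. -/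
def CentralScalars (K D : Type*) [Field K] [DivisionRing D] [Algebra K D] : Prop :=
  ∀ c : D, (∀ x, c * x = x * c) → ∃ κ : K, algebraMap K D κ = c

lemma gpi_left (hZ : CentralScalars K D) {p p' q q' : D}
    (h : ∀ z, p * z * q + p' * z * q' = 0) :
    (q = 0 ∧ q' = 0) ∨ ∃ μ₁ μ₂ : K, (μ₁ ≠ 0 ∨ μ₂ ≠ 0) ∧ μ₁ • p + μ₂ • p' = 0 := by
  by_cases hp : p = 0
  · exact Or.inr ⟨1, 0, Or.inl one_ne_zero, by simp [hp]⟩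
  set c := p⁻¹ * p' with hc
  have h1 : ∀ z, z * q + c * z * q' = 0 := fun z => by
    have := congrArg (p⁻¹ * ·) (h z)
    simpa [mul_add, ← mul_assoc, hp, hc] using this
  have hq : q = -(c * q') := by
    have := h1 1
    simp only [one_mul, mul_one] at this
    exact eq_neg_of_add_eq_zero_left this
  by_cases hq' : q' = 0
  · exact Or.inl ⟨by simp [hq, hq'], hq'⟩
  right
  obtain ⟨κ, hκ⟩ := hZ c (fun z => by
    have := h1 z
    rw [hq] at this
    have h2 : (c * z) * q' = (z * c) * q' := by
      rw [mul_neg, ← mul_assoc, neg_add_eq_zero] at this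
      exact this.symm
    exact mul_right_cancel₀ hq' h2)
  refine ⟨κ, -1, Or.inr (by simp), ?_⟩
  have : p' = p * c := by simp [hc, hp]
  rw [Algebra.smul_def, neg_smul, one_smul, this, ← hκ, Algebra.commutes, add_neg_cancel]

lemma gpi_right (hZ : CentralScalars K D) {p p' q q' : D}
    (h : ∀ z, p * z * q + p' * z * q' = 0) :
    (p = 0 ∧ p' = 0) ∨ ∃ μ₁ μ₂ : K, (μ₁ ≠ 0 ∨ μ₂ ≠ 0) ∧ μ₁ • q + μ₂ • q' = 0 := by
  by_cases hp : q = 0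
  · exact Or.inr ⟨1, 0, Or.inl one_ne_zero, by simp [hp]⟩
  set c := q' * q⁻¹ with hc
  have h1 : ∀ z, p * z + p' * z * c = 0 := fun z => by
    have := congrArg (· * q⁻¹) (h z)
    simpa [add_mul, mul_assoc, hp, hc] using this
  have hq : p = -(p' * c) := by
    have := h1 1
    simp only [mul_one] at this
    exact eq_neg_of_add_eq_zero_left this
  by_cases hq' : p' = 0
  · exact Or.inl ⟨by simp [hq, hq'], hq'⟩
  right
  obtain ⟨κ, hκ⟩ := hZ c (fun z => by
    have := h1 z
    rw [hq] at this
    have h2 : p' * (c * z) = p' * (z * c) := by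
      rw [neg_mul, neg_add_eq_zero] at this
      rw [← mul_assoc p' c z, ← mul_assoc p' z c, this]
    exact mul_left_cancel₀ hq' h2)
  refine ⟨κ, -1, Or.inr (by simp), ?_⟩
  have : q' = c * q := by simp [hc, hp]
  rw [Algebra.smul_def, hκ, neg_smul, one_smul, this, add_neg_cancel]

lemma not_all_scalar (hNC : ∃ x y : D, x * y ≠ y * x) :
    ¬ ∀ x : D, ∃ κ : K, algebraMap K D κ = x := by
  intro h
  obtain ⟨x, y, hxy⟩ := hNC
  obtain ⟨κ, rfl⟩ := h x
  exact hxy (Algebra.commutes κ y)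

lemma gpi_scalar_one (hNC : ∃ x y : D, x * y ≠ y * x) {p q : D}
    (h : ∀ z, ∃ κ : K, p * z * q = algebraMap K D κ) : p = 0 ∨ q = 0 := by
  by_contra! hpq
  refine not_all_scalar (K := K) hNC fun x => ?_
  obtain ⟨κ, hκ⟩ := h (p⁻¹ * x * q⁻¹)
  refine ⟨κ, ?_⟩
  rw [← hκ]
  have : p * (p⁻¹ * x * q⁻¹) * q = (p * p⁻¹) * x * (q⁻¹ * q) := by simp only [mul_assoc]
  simp [this, hpq.1, hpq.2]

lemma gpi_scalar_aux (hZ : CentralScalars K D) (hNC : ∃ x y : D, x * y ≠ y * x) {c e : D}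
    (h : ∀ z, ∃ κ : K, z * e + c * z = algebraMap K D κ) : ∀ z, z * e + c * z = 0 := by
  obtain ⟨k, hk⟩ := h 1
  have he : e = algebraMap K D k - c := by rw [← hk]; simp
  have h1 : ∀ z, ∃ κ : K, algebraMap K D k * z + (c * z - z * c) = algebraMap K D κ := fun z => by
    obtain ⟨κ, hκ⟩ := h z
    refine ⟨κ, ?_⟩
    rw [← hκ, he, mul_sub, ← Algebra.commutes k z]
    abel
  by_cases hc : ∃ κ : K, algebraMap K D κ = c
  · obtain ⟨κ, rfl⟩ := hc
    have h2 : ∀ z, ∃ κ' : K, e * z + algebraMap K D κ * z = algebraMap K D κ' := fun z => by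
      obtain ⟨κ', h'⟩ := h z
      refine ⟨κ', ?_⟩
      rw [← h', he, mul_sub, sub_mul, Algebra.commutes k z, Algebra.commutes κ z]
    have h3 := gpi_scalar_one (K := K) (p := e + algebraMap K D κ) (q := 1) hNC
      (by simpa [add_mul] using h2)
    simp only [one_ne_zero, or_false] at h3
    intro z
    rw [Algebra.commutes κ z, ← mul_add, h3, mul_zero]
  exfalso
  apply hc
  have hk0 : k = 0 := by
    by_contra hk0
    obtain ⟨κ, hκ⟩ := h1 c
    refine hc ⟨k⁻¹ * κ, ?_⟩
    rw [sub_self, add_zero] at hκ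
    rw [map_mul, ← hκ, ← mul_assoc, ← map_mul, inv_mul_cancel₀ hk0, map_one, one_mul]
  subst hk0
  simp only [map_zero, zero_mul, zero_add] at h1
  refine hZ c fun z => ?_
  by_contra hz
  obtain ⟨κ₁, e₁⟩ := h1 z
  obtain ⟨κ₂, e₂⟩ := h1 (c * z)
  have h2 : c * algebraMap K D κ₁ = algebraMap K D κ₂ := by
    rw [← e₁, ← e₂, mul_sub, mul_assoc]
  have h3 : κ₁ ≠ 0 := fun h0 => hz (by rw [h0, map_zero, sub_eq_zero] at e₁; exact e₁)
  refine hc ⟨κ₂ * κ₁⁻¹, ?_⟩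
  rw [map_mul, ← h2, mul_assoc, ← map_mul, mul_inv_cancel₀ h3, map_one, mul_one]

lemma gpi_scalar_two (hZ : CentralScalars K D) (hNC : ∃ x y : D, x * y ≠ y * x)
    {p p' q q' : D} (h : ∀ z, ∃ κ : K, p * z * q + p' * z * q' = algebraMap K D κ) :
    ∀ z, p * z * q + p' * z * q' = 0 := by
  by_cases hp : p = 0
  · subst hp
    rcases gpi_scalar_one (K := K) hNC (p := p') (q := q') (by simpa using h) with h | h <;> simp [h]
  by_cases hq : q' = 0
  · subst hq
    rcases gpi_scalar_one (K := K) hNC (p := p) (q := q) (by simpa using h) with h | h <;> simp [h]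
  have hqp : q' * p ≠ 0 := mul_ne_zero hq hp
  have h1 := gpi_scalar_aux hZ hNC (c := q' * p' * (q' * p)⁻¹) (e := q * q'⁻¹) fun y => by
    obtain ⟨κ, hκ⟩ := h ((q' * p)⁻¹ * y)
    refine ⟨κ, ?_⟩
    have h2 := congrArg (fun x => q' * x * q'⁻¹) hκ
    rw [← Algebra.commutes κ q', mul_assoc _ q', mul_inv_cancel₀ hq, mul_one] at h2
    rw [← h2, mul_add, add_mul]
    congr 1
    · rw [← mul_assoc, ← mul_assoc, ← mul_assoc, ← mul_assoc, mul_inv_cancel₀ hqp, one_mul]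
    · simp only [mul_assoc, mul_inv_cancel₀ hq, mul_one]
  intro z
  have h2 := h1 (q' * p * z)
  have h3 : q' * (p * z * q + p' * z * q') * q'⁻¹ = 0 := by
    rw [← h2, mul_add, add_mul]
    congr 1
    · simp only [mul_assoc]
    · rw [mul_assoc (q' * p'), ← mul_assoc _ (q' * p), inv_mul_cancel₀ hqp, one_mul]
      simp only [mul_assoc, mul_inv_cancel₀ hq, mul_one]
  simpa [hq] using h3

lemma gpi_line_two (hZ : CentralScalars K D) (hNC : ∃ x y : D, x * y ≠ y * x)
    {p p' q q' g : D} (hg : g ≠ 0) (h : ∀ z, ∃ κ : K, p * z * q + p' * z * q' = κ • g) :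
    ∀ z, p * z * q + p' * z * q' = 0 := by
  have h1 := gpi_scalar_two hZ hNC (p := p) (p' := p') (q := q * g⁻¹) (q' := q' * g⁻¹) fun z => by
    obtain ⟨κ, hκ⟩ := h z
    refine ⟨κ, ?_⟩
    rw [← mul_assoc, ← mul_assoc, ← add_mul, hκ, Algebra.smul_def, mul_assoc, mul_inv_cancel₀ hg,
      mul_one]
  intro z
  have := h1 z
  rw [← mul_assoc, ← mul_assoc, ← add_mul] at this
  simpa [hg] using this

lemma gpi_square (hZ : CentralScalars K D) (hNC : ∃ x y : D, x * y ≠ y * x)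
    {p n q g : D} (hg : g ≠ 0) (h : ∀ z, ∃ κ : K, p * z * n * z * q = κ • g) :
    p = 0 ∨ n = 0 ∨ q = 0 := by
  by_contra! hc
  obtain ⟨hp, hn, hq⟩ := hc
  have h1 : ∀ y : D, ∃ κ : K, p * n⁻¹ * (y * y) * q = κ • g := fun y => by
    obtain ⟨κ, hκ⟩ := h (n⁻¹ * y)
    refine ⟨κ, ?_⟩
    rw [← hκ]
    have : p * (n⁻¹ * y) * n * (n⁻¹ * y) * q = p * n⁻¹ * (y * (n * n⁻¹ * y)) * q := by
      simp only [mul_assoc]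
    rw [this, mul_inv_cancel₀ hn, one_mul]
  have hr : p * n⁻¹ ≠ 0 := mul_ne_zero hp (inv_ne_zero hn)
  set r := p * n⁻¹
  have h2 : ∀ u : D, ∀ z, r * z * (u * q) + (r * u) * z * q = 0 := fun u => by
    refine gpi_line_two hZ hNC hg fun z => ?_
    obtain ⟨κ₁, e₁⟩ := h1 (z + u)
    obtain ⟨κ₂, e₂⟩ := h1 z
    obtain ⟨κ₃, e₃⟩ := h1 u
    refine ⟨κ₁ - κ₂ - κ₃, ?_⟩
    rw [sub_smul, sub_smul, ← e₁, ← e₂, ← e₃]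
    noncomm_ring
  have h3 : ∀ u z : D, z * u + u * z = 0 := fun u z => by
    have h4 : r * (z * u + u * z) * q = 0 := by
      rw [← h2 u z]; noncomm_ring
    simpa [hr, hq] using h4
  obtain ⟨x, y, hxy⟩ := hNC
  apply hxy
  have h5 := h3 1 1
  have h6 := h3 x y
  have h7 : y * x + y * x = 0 := by
    have : y * x + y * x = (y * x) * (1 * 1 + 1 * 1) := by noncomm_ring
    rw [this, h5, mul_zero]
  rw [← sub_eq_zero]
  have : x * y - y * x = (y * x + x * y) - (y * x + y * x) := by noncomm_ring
  rw [this, h6, h7, sub_zero]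

/-- If `g y h = h y g` for all `y` and `h ≠ 0`, then `g` is a scalar multiple of `h`. -/
lemma smul_of_cross (hZ : CentralScalars K D) {g h : D} (hh : h ≠ 0)
    (hc : ∀ y, g * y * h = h * y * g) : ∃ κ : K, g = κ • h := by
  rcases gpi_left hZ (p := g) (p' := -h) (q := h) (q' := g) (fun z => by
    rw [hc z]; noncomm_ring) with h1 | ⟨μ₁, μ₂, h0, h1⟩
  · exact absurd h1.1 hh
  · rw [smul_neg, ← sub_eq_add_neg, sub_eq_zero] at h1
    have hm : μ₁ ≠ 0 := by
      rintro rfl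
      have : μ₂ ≠ 0 := by simpa using h0
      rw [zero_smul, eq_comm, smul_eq_zero] at h1
      exact h1.elim this hh
    exact ⟨μ₁⁻¹ * μ₂, by rw [mul_smul, ← h1, smul_smul, inv_mul_cancel₀ hm, one_smul]⟩

end GPI

section Pencil

open Filter

variable {K D : Type*} [Field K] [DivisionRing D] [Algebra K D]

/-- The rows of `N` are left linearly independent over `D`. -/
def LeftRegular {ι : Type*} [Fintype ι] (N : Matrix ι ι D) : Prop :=
  ∀ v : ι → D, v ᵥ* N = 0 → v = 0

lemma LeftRegular.eventually {ι : Type*} [Fintype ι] {N : Matrix ι ι D}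
    (hN : LeftRegular N) (C : Matrix ι ι D) :
    ∀ᶠ t : K in cofinite, LeftRegular (N + t • C) := by
  classical
  set f : (ι → D) →ₗ[D] (ι → D) := N.vecMulLinear
  have hf : Function.Injective f := by
    rw [injective_iff_map_eq_zero]; exact hN
  set e : (ι → D) ≃ₗ[D] (ι → D) := LinearEquiv.ofInjectiveEndo f hf
  set T : (ι → D) →ₗ[D] (ι → D) := e.symm.toLinearMap ∘ₗ C.vecMulLinear
  have he : ∀ v, e v = v ᵥ* N := fun v => rfl
  rw [eventually_cofinite]
  set bad : Set K := {t | ¬ LeftRegular (N + t • C)}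
  have h1 : ∀ t : bad, ∃ v : ι → D, v ≠ 0 ∧ (t : K) ≠ 0 ∧ T v = (-(t : K)⁻¹) • v := by
    rintro ⟨t, ht⟩
    simp only [bad, LeftRegular, Set.mem_ofPred_eq, not_forall] at ht
    obtain ⟨v, hv, hv0⟩ := ht
    have ht0 : t ≠ 0 := by
      rintro rfl
      exact hv0 (hN v (by simpa using hv))
    refine ⟨v, hv0, ht0, ?_⟩
    change e.symm (v ᵥ* C) = _
    rw [LinearEquiv.symm_apply_eq, he, Matrix.smul_vecMul, eq_comm]
    rw [Matrix.vecMul_add, Matrix.vecMul_smul] at hv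
    rw [eq_neg_of_add_eq_zero_left hv, smul_neg, neg_smul, neg_neg, smul_smul,
      inv_mul_cancel₀ ht0, one_smul]
  choose v hv0 ht0 hTv using h1
  have hli : LinearIndependent D v := by
    rw [linearIndependent_iff']
    intro s g hg i hi
    by_contra hgi
    set s' := s.filter (fun j => g j ≠ 0) with hs'
    let T' : Module.End K (ι → D) := T.restrictScalars K
    have hli' := Module.End.eigenvectors_linearIndependent' T' (ι := s')
      (fun j => -((j : bad) : K)⁻¹) (fun x y hxy => by
        have := neg_injective hxy
        exact Subtype.ext (Subtype.ext (inv_injective this)))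
      (fun j => g j • v j) (fun j => by
        refine ⟨?_, ?_⟩
        · rw [Module.End.mem_eigenspace_iff]
          change T (g j • v j) = _
          rw [map_smul, hTv, smul_comm]
        · have h2 : g (j : bad) ≠ 0 := (Finset.mem_filter.1 j.2).2
          exact smul_ne_zero h2 (hv0 _))
    rw [Fintype.linearIndependent_iff] at hli'
    have h3 := hli' (fun _ => 1) (by
      simp only [one_smul]
      rw [Finset.sum_coe_sort s' (fun j => g j • v j), hs', Finset.sum_filter_of_ne]
      · exact hg
      · intro x _ hx h0
        exact hx (by rw [h0, zero_smul])) ⟨i, by simp [hs', hi, hgi]⟩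
    exact one_ne_zero h3
  have := hli.finite
  exact Set.toFinite _

/-- A function `K → D` that near `0` and for almost all parameters is given by
`t ↦ e (N + t C)⁻¹ w`, with `N` regular. -/
def PencilFun (f : K → D) : Prop :=
  ∃ (ι : Type) (_ : Fintype ι) (_ : DecidableEq ι) (N C : Matrix ι ι D) (e w : ι → D),
    LeftRegular N ∧ ∀ᶠ t : K in cofinite ⊔ pure 0, ∃ z, z ᵥ* (N + t • C) = e ∧ f t = z ⬝ᵥ w

lemma PencilFun.mul_const {f : K → D} (hf : PencilFun f) (c : D) :
    PencilFun fun t => f t * c := by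
  obtain ⟨ι, _, _, N, C, e, w, hN, h⟩ := hf
  refine ⟨ι, _, inferInstance, N, C, e, fun i => w i * c, hN, h.mono ?_⟩
  rintro t ⟨z, hz, hft⟩
  refine ⟨z, hz, ?_⟩
  beta_reduce
  rw [hft]
  simp [dotProduct, Finset.sum_mul, mul_assoc]

lemma PencilFun.sub {f g : K → D} (hf : PencilFun f) (hg : PencilFun g) :
    PencilFun fun t => f t - g t := by
  obtain ⟨ι, _, _, N, C, e, w, hN, h⟩ := hf
  obtain ⟨ι', _, _, N', C', e', w', hN', h'⟩ := hg
  refine ⟨ι ⊕ ι', inferInstance, inferInstance, fromBlocks N 0 0 N', fromBlocks C 0 0 C',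
    Sum.elim e e', Sum.elim w (-w'), ?_, (h.and h').mono ?_⟩
  · intro v hv
    rw [← Sum.elim_comp_inl_inr v, vecMul_fromBlocks] at hv
    have h1 := hN (v ∘ Sum.inl) (by simpa using congrArg (· ∘ Sum.inl) hv)
    have h2 := hN' (v ∘ Sum.inr) (by simpa using congrArg (· ∘ Sum.inr) hv)
    rw [← Sum.elim_comp_inl_inr v, h1, h2]
    ext (i | i) <;> rfl
  · rintro t ⟨⟨z, hz, hft⟩, z', hz', hgt⟩
    refine ⟨Sum.elim z z', ?_, ?_⟩
    · rw [fromBlocks_smul, fromBlocks_add, vecMul_fromBlocks]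
      simp [hz, hz']
    · beta_reduce
      rw [hft, hgt, sumElim_dotProduct_sumElim, dotProduct_neg, sub_eq_add_neg]

lemma PencilFun.mul {f g : K → D} (hf : PencilFun f) (hg : PencilFun g) :
    PencilFun fun t => f t * g t := by
  obtain ⟨ι, _, _, N, C, e, w, hN, h⟩ := hf
  obtain ⟨ι', _, _, N', C', e', w', hN', h'⟩ := hg
  refine ⟨ι ⊕ ι', inferInstance, inferInstance, fromBlocks N (-vecMulVec w e') 0 N',
    fromBlocks C 0 0 C', Sum.elim e 0, Sum.elim 0 w', ?_, (h.and h').mono ?_⟩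
  · intro v hv
    rw [← Sum.elim_comp_inl_inr v, vecMul_fromBlocks] at hv
    have h1 := hN (v ∘ Sum.inl) (by simpa using congrArg (· ∘ Sum.inl) hv)
    have h2 := hN' (v ∘ Sum.inr) (by
      rw [h1] at hv
      simpa using congrArg (· ∘ Sum.inr) hv)
    rw [← Sum.elim_comp_inl_inr v, h1, h2]
    ext (i | i) <;> rfl
  · rintro t ⟨⟨z, hz, hft⟩, z', hz', hgt⟩
    refine ⟨Sum.elim z (f t • z'), ?_, ?_⟩
    · rw [fromBlocks_smul, fromBlocks_add, vecMul_fromBlocks]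
      have : f t • e' = z ᵥ* vecMulVec w e' := by
        rw [hft]; ext i
        simp [vecMul, vecMulVec, dotProduct, Finset.sum_mul, mul_assoc]
      simp [hz, Matrix.smul_vecMul, hz', Matrix.vecMul_neg, this]
    · beta_reduce
      rw [hgt, sumElim_dotProduct_sumElim, dotProduct_zero, zero_add, smul_dotProduct, smul_eq_mul]

lemma PencilFun.eventually_ne_zero {f : K → D} (hf : PencilFun f) (h0 : f 0 ≠ 0) :
    ∀ᶠ t : K in cofinite, f t ≠ 0 := by
  obtain ⟨ι, _, _, N, C, e, w, hN, h⟩ := hf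
  rw [eventually_sup, eventually_pure] at h
  obtain ⟨h, z, hz, hz0⟩ := h
  rw [zero_smul, add_zero] at hz
  have h1 : LeftRegular (fromBlocks N (of fun i (_ : Unit) => w i) (of fun (_ : Unit) i => e i) 0) := by
    intro v hv
    rw [← Sum.elim_comp_inl_inr v, vecMul_fromBlocks] at hv
    have e1 := congrArg (· ∘ Sum.inl) hv
    have e2 := congrArg (· ∘ Sum.inr) hv
    set v1 := v ∘ Sum.inl
    set α := v (Sum.inr ())
    have hα : (v ∘ Sum.inr) ᵥ* (of fun (_ : Unit) i => e i) = α • e := by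
      ext i; simp [vecMul, dotProduct, α]
    have e1' : v1 ᵥ* N + α • e = 0 := by
      rw [← hα]; simpa using e1
    have e2' : v1 ⬝ᵥ w = 0 := by
      have := congrFun e2 ()
      simpa [vecMul] using this
    have e3 : v1 + α • z = 0 := hN _ (by rw [Matrix.add_vecMul, Matrix.smul_vecMul, hz, e1'])
    have e4 : v1 = -(α • z) := eq_neg_of_add_eq_zero_left e3
    have e5 : α = 0 := by
      rw [e4, neg_dotProduct, smul_dotProduct, ← hz0, neg_eq_zero, smul_eq_mul] at e2'
      exact (mul_eq_zero.1 e2').resolve_right h0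
    have e6 : v1 = 0 := by rw [e4, e5, zero_smul, neg_zero]
    rw [← Sum.elim_comp_inl_inr v]
    ext (i | i)
    · exact congrFun e6 i
    · exact e5
  filter_upwards [h, h1.eventually (K := K) (fromBlocks C 0 0 0)] with t ht ht'
  intro hft
  obtain ⟨z, hz, hzf⟩ := ht
  have := ht' (Sum.elim (-z) (fun _ => 1)) (by
    rw [fromBlocks_smul, fromBlocks_add, vecMul_fromBlocks]
    ext (i | i)
    · simp [Matrix.neg_vecMul, hz]
      simp [vecMul, dotProduct]
    · have := hzf.symm.trans hft
      simpa [vecMul] using this)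
  exact one_ne_zero (congrFun this (Sum.inr ()))

lemma PencilFun.eq_zero [Infinite K] {f : K → D} (hf : PencilFun f)
    (h0 : ∀ᶠ t : K in cofinite, f t = 0) : f 0 = 0 := by
  by_contra h
  obtain ⟨t, h1, h2⟩ := (h0.and (hf.eventually_ne_zero h)).exists
  exact h2 h1

end Pencil

section Core

open Filter

variable {K D : Type*} [Field K] [DivisionRing D] [Algebra K D]

lemma LeftRegular.isUnit {ι : Type*} [Fintype ι] [DecidableEq ι] {N : Matrix ι ι D}
    (h : LeftRegular N) : IsUnit N := by
  have hinj : Function.Injective N.vecMulLinear := by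
    rw [injective_iff_map_eq_zero]; exact h
  have hsurj := LinearMap.surjective_of_injective hinj
  choose Z hZ using fun i => hsurj (Pi.single i 1)
  have h1 : of Z * N = 1 := by
    ext i j
    have := congrFun (hZ i) j
    rw [Matrix.vecMulLinear_apply] at this
    rw [Matrix.mul_apply_eq_vecMul]
    change (Z i ᵥ* N) j = _
    rw [this]
    simp [Matrix.one_apply, Pi.single_apply, eq_comm]
  have h2 : N * of Z = 1 := by
    rw [← sub_eq_zero]
    have h3 : (N * of Z - 1) * N = 0 := by
      rw [sub_mul, mul_assoc, h1, mul_one, one_mul, sub_self]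
    funext i
    apply h
    rw [← Matrix.mul_apply_eq_vecMul, h3]
    rfl
  exact ⟨⟨N, of Z, h2, h1⟩, rfl⟩

lemma leftRegular_of_isUnit {ι : Type*} [Fintype ι] [DecidableEq ι] {N : Matrix ι ι D}
    (h : IsUnit N) : LeftRegular N := by
  obtain ⟨u, rfl⟩ := h
  intro v hv
  have := congrArg (· ᵥ* (↑u⁻¹ : Matrix ι ι D)) hv
  simpa [Matrix.vecMul_vecMul] using this

lemma IsUnit.eventually_pencil {ι : Type*} [Fintype ι] [DecidableEq ι] {N : Matrix ι ι D}
    (h : IsUnit N) (C : Matrix ι ι D) :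
    ∀ᶠ t : K in cofinite ⊔ pure 0, IsUnit (N + t • C) := by
  rw [eventually_sup, eventually_pure]
  refine ⟨((leftRegular_of_isUnit h).eventually C).mono fun t ht => ht.isUnit, by simpa using h⟩

lemma pencilFun_inverse {n : ℕ} {N : Matrix (Fin n) (Fin n) D} (h : IsUnit N)
    (C : Matrix (Fin n) (Fin n) D) (l r : Fin n → D) :
    PencilFun fun t : K => l ⬝ᵥ (Ring.inverse (N + t • C) *ᵥ r) := by
  refine ⟨Fin n, inferInstance, inferInstance, N, C, l, r, leftRegular_of_isUnit h, ?_⟩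
  filter_upwards [h.eventually_pencil C] with t ht
  refine ⟨l ᵥ* Ring.inverse (N + t • C), ?_, by rw [dotProduct_mulVec]⟩
  rw [Matrix.vecMul_vecMul, Ring.inverse_mul_cancel _ ht, Matrix.vecMul_one]

/-- The extension of scalars of a vector along `K → D`. -/
def extScal (D : Type*) [DivisionRing D] [Algebra K D] {n : ℕ} (v : Fin n → K) : Fin n → D :=
  fun i => algebraMap K D (v i)

lemma dotProduct_smul_vecMulVec {n : ℕ} (σ τ : Fin n → K) (l r : Fin n → D) (z : D) :
    l ⬝ᵥ ((z • (vecMulVec σ τ).map (algebraMap K D)) *ᵥ r) =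
      (l ⬝ᵥ extScal D σ) * z * (extScal D τ ⬝ᵥ r) := by
  simp only [dotProduct, mulVec, extScal, Finset.sum_mul, Finset.mul_sum]
  rw [Finset.sum_comm]
  refine Finset.sum_congr rfl fun j _ => Finset.sum_congr rfl fun i _ => ?_
  simp only [Matrix.smul_apply, Matrix.map_apply, vecMulVec_apply, map_mul, smul_eq_mul]
  rw [← mul_assoc z, ← Algebra.commutes (σ i) z]
  simp only [mul_assoc]

lemma dotProduct_smul_rankTwo {n : ℕ} {B : Matrix (Fin n) (Fin n) K} {σ τ σ' τ' : Fin n → K}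
    (hB : B = vecMulVec σ τ + vecMulVec σ' τ') (l r : Fin n → D) (z : D) :
    l ⬝ᵥ ((z • B.map (algebraMap K D)) *ᵥ r) =
      (l ⬝ᵥ extScal D σ) * z * (extScal D τ ⬝ᵥ r) + (l ⬝ᵥ extScal D σ') * z * (extScal D τ' ⬝ᵥ r) := by
  rw [hB, Matrix.map_add _ (map_add _), smul_add, Matrix.add_mulVec, dotProduct_add,
    dotProduct_smul_vecMulVec, dotProduct_smul_vecMulVec]

lemma resolvent_right {n : ℕ} {M C : Matrix (Fin n) (Fin n) D} {t : K} (h0 : IsUnit M)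
    (ht : IsUnit (M + t • C)) (l r : Fin n → D) :
    l ⬝ᵥ (Ring.inverse (M + t • C) *ᵥ r) = l ⬝ᵥ (Ring.inverse M *ᵥ r) -
      t • ((l ᵥ* Ring.inverse (M + t • C)) ⬝ᵥ (C *ᵥ (Ring.inverse M *ᵥ r))) := by
  have : Ring.inverse (M + t • C) = Ring.inverse M -
      t • (Ring.inverse (M + t • C) * (C * Ring.inverse M)) := by
    have h1 : Ring.inverse (M + t • C) * (M + t • C) * Ring.inverse M = Ring.inverse M := by
      rw [Ring.inverse_mul_cancel _ ht, one_mul]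
    rw [mul_add, add_mul, mul_assoc, Ring.mul_inverse_cancel _ h0, mul_one] at h1
    rw [← mul_assoc]
    conv_lhs => rw [eq_sub_of_add_eq h1]
    rw [Matrix.mul_smul, Matrix.smul_mul]
  conv_lhs => rw [this]
  rw [Matrix.sub_mulVec, dotProduct_sub, Matrix.smul_mulVec, dotProduct_smul, mulVec_mulVec,
    ← dotProduct_mulVec, mulVec_mulVec]

lemma resolvent_left {n : ℕ} {M C : Matrix (Fin n) (Fin n) D} {t : K} (h0 : IsUnit M)
    (ht : IsUnit (M + t • C)) (l r : Fin n → D) :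
    l ⬝ᵥ (Ring.inverse (M + t • C) *ᵥ r) = l ⬝ᵥ (Ring.inverse M *ᵥ r) -
      t • ((l ᵥ* Ring.inverse M) ⬝ᵥ (C *ᵥ (Ring.inverse (M + t • C) *ᵥ r))) := by
  have : Ring.inverse (M + t • C) = Ring.inverse M -
      t • (Ring.inverse M * (C * Ring.inverse (M + t • C))) := by
    have h1 : Ring.inverse M * ((M + t • C) * Ring.inverse (M + t • C)) = Ring.inverse M := by
      rw [Ring.mul_inverse_cancel _ ht, mul_one]
    rw [add_mul, mul_add, ← mul_assoc, Ring.inverse_mul_cancel _ h0, one_mul] at h1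
    conv_lhs => rw [eq_sub_of_add_eq h1]
    rw [Matrix.smul_mul, Matrix.mul_smul]
  conv_lhs => rw [this]
  rw [Matrix.sub_mulVec, dotProduct_sub, Matrix.smul_mulVec, dotProduct_smul, mulVec_mulVec,
    ← dotProduct_mulVec, mulVec_mulVec]

lemma exists_rankTwo_decomp {n : ℕ} (a b : Fin n → K) {μ₁ μ₂ : K} (h : μ₁ ≠ 0 ∨ μ₂ ≠ 0) :
    ∃ σ τ τ' : Fin n → K, vecMulVec a b - vecMulVec b a =
      vecMulVec σ τ + vecMulVec (μ₁ • a + μ₂ • b) τ' := by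
  rcases h with h | h
  · refine ⟨b, -a - (μ₁⁻¹ * μ₂) • b, μ₁⁻¹ • b, ?_⟩
    ext i j
    simp only [vecMulVec_apply, Matrix.sub_apply, Matrix.add_apply, Pi.sub_apply, Pi.neg_apply,
      Pi.smul_apply, Pi.add_apply, smul_eq_mul]
    field_simp
    ring
  · refine ⟨a, b + (μ₂⁻¹ * μ₁) • a, - μ₂⁻¹ • a, ?_⟩
    ext i j
    simp only [vecMulVec_apply, Matrix.sub_apply, Matrix.add_apply,
      Pi.smul_apply, Pi.add_apply, smul_eq_mul]
    field_simp
    ring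

lemma PencilFun.exists_smul_eq [Infinite K] (hZ : CentralScalars K D) {f h : K → D}
    (hf : PencilFun f) (hh : PencilFun h) (h0 : h 0 ≠ 0)
    (hev : ∀ᶠ t : K in cofinite, ∃ κ : K, f t = κ • h t) : ∃ κ : K, f 0 = κ • h 0 := by
  refine smul_of_cross hZ h0 fun y => ?_
  rw [← sub_eq_zero]
  refine PencilFun.eq_zero (((hf.mul_const y).mul hh).sub ((hh.mul_const y).mul hf)) ?_
  filter_upwards [hev] with t ⟨κ, hκ⟩
  rw [hκ, smul_mul_assoc, smul_mul_assoc, mul_smul_comm, sub_self]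

/-- The extension of scalars of the wedge product of `a` and `b`. -/
def wedgeScal (D : Type*) [DivisionRing D] [Algebra K D] {n : ℕ} (a b : Fin n → K) :
    Matrix (Fin n) (Fin n) D :=
  (vecMulVec a b - vecMulVec b a).map (algebraMap K D)

lemma form_wedgeScal {n : ℕ} (a b : Fin n → K) (l r : Fin n → D) (z : D) :
    l ⬝ᵥ ((z • wedgeScal D a b) *ᵥ r) =
      (l ⬝ᵥ extScal D a) * z * (extScal D b ⬝ᵥ r) +
        (-(l ⬝ᵥ extScal D b)) * z * (extScal D a ⬝ᵥ r) := by
  have h : vecMulVec a b - vecMulVec b a = vecMulVec a b + vecMulVec b (-a) := by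
    rw [Matrix.vecMulVec_neg, sub_eq_add_neg]
  rw [wedgeScal, dotProduct_smul_rankTwo h]
  have : extScal D (-a) = - extScal D a := by
    funext i; simp [extScal]
  rw [this, neg_dotProduct, mul_neg, neg_mul, neg_mul]

lemma extScal_comb {n : ℕ} (a b : Fin n → K) (μ₁ μ₂ : K) :
    extScal D (μ₁ • a + μ₂ • b) = μ₁ • extScal D a + μ₂ • extScal D b := by
  funext i
  simp [extScal, Algebra.smul_def]

lemma eventually_ne_zero_cofinite : ∀ᶠ t : K in cofinite, t ≠ 0 := by
  rw [eventually_cofinite]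
  simp

/-- Rigidity along a line of pencils: if `c` is killed by the row `e (M + t z W)⁻¹` at `t = 0`,
while for almost all `t` its image is a `K`-multiple of the image of `f`, then `c` is killed for
almost all `t`. -/
lemma eventually_killed [Infinite K] (hZ : CentralScalars K D)
    (hNC : ∃ x y : D, x * y ≠ y * x) {n : ℕ} {M : Matrix (Fin n) (Fin n) D} (hM : IsUnit M)
    (a b : Fin n → K) (e c f : Fin n → D)
    (hc : e ⬝ᵥ (Ring.inverse M *ᵥ c) = 0) (hf : e ⬝ᵥ (Ring.inverse M *ᵥ f) ≠ 0)
    (h : ∀ z : D, ∀ᶠ t : K in cofinite, ∃ κ : K,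
      e ⬝ᵥ (Ring.inverse (M + t • (z • wedgeScal D a b)) *ᵥ c) =
        κ • (e ⬝ᵥ (Ring.inverse (M + t • (z • wedgeScal D a b)) *ᵥ f))) (z : D) :
    ∀ᶠ t : K in cofinite, e ⬝ᵥ (Ring.inverse (M + t • (z • wedgeScal D a b)) *ᵥ c) = 0 := by
  have hU : ∀ z : D, ∀ᶠ t : K in cofinite, IsUnit (M + t • (z • wedgeScal D a b)) := fun z =>
    (hM.eventually_pencil _).filter_mono le_sup_left
  set W := wedgeScal D a b with hW
  set q := Ring.inverse M *ᵥ c with hq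
  set l := e ᵥ* Ring.inverse M with hl
  have key : ∀ z : D, l ⬝ᵥ ((z • W) *ᵥ q) = 0 := by
    have h1 : ∀ z : D, ∃ κ : K, l ⬝ᵥ ((z • W) *ᵥ q) = κ • (e ⬝ᵥ (Ring.inverse M *ᵥ f)) := fun z => by
      have := PencilFun.exists_smul_eq hZ (pencilFun_inverse hM (z • W) e ((z • W) *ᵥ q))
        (pencilFun_inverse hM (z • W) e f) (by simpa using hf) (by
          filter_upwards [h z, hU z, eventually_ne_zero_cofinite] with t ⟨κ, hκ⟩ ht ht0
          refine ⟨-(t⁻¹ * κ), ?_⟩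
          rw [resolvent_right hM ht, ← hq, hc, zero_sub, ← dotProduct_mulVec] at hκ
          rw [neg_smul, mul_smul, ← hκ, smul_neg, neg_neg, smul_smul, inv_mul_cancel₀ ht0,
            one_smul])
      simpa [dotProduct_mulVec, hl] using this
    have h2 := gpi_line_two hZ hNC (p := l ⬝ᵥ extScal D a) (p' := -(l ⬝ᵥ extScal D b))
      (q := extScal D b ⬝ᵥ q) (q' := extScal D a ⬝ᵥ q) hf (fun z => by
        rw [← form_wedgeScal]; exact h1 z)
    intro z
    rw [hW, form_wedgeScal, h2 z]
  rcases gpi_left hZ (fun z => (form_wedgeScal a b l q z).symm.trans (key z)) with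
    ⟨hbq, haq⟩ | ⟨μ₁, μ₂, hμ, hl0⟩
  · filter_upwards [hU z] with t ht
    rw [resolvent_right hM ht, ← hq, hc, zero_sub, hW, form_wedgeScal, hbq, haq]
    simp
  obtain ⟨σ, τ, τ', hdec⟩ := exists_rankTwo_decomp a b (μ₁ := μ₁) (μ₂ := -μ₂) (by simpa using hμ)
  set σ' := μ₁ • a + -μ₂ • b
  have hform : ∀ (l r : Fin n → D) (z : D), l ⬝ᵥ ((z • W) *ᵥ r) =
      (l ⬝ᵥ extScal D σ) * z * (extScal D τ ⬝ᵥ r) +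
        (l ⬝ᵥ extScal D σ') * z * (extScal D τ' ⬝ᵥ r) := fun l r z =>
    dotProduct_smul_rankTwo hdec l r z
  have hlσ' : l ⬝ᵥ extScal D σ' = 0 := by
    rw [extScal_comb, dotProduct_add, dotProduct_smul, dotProduct_smul, neg_smul, ← smul_neg]
    exact hl0
  have hlστ : ∀ z : D, l ⬝ᵥ extScal D σ * z * (extScal D τ ⬝ᵥ q) = 0 := fun z => by
    have := key z
    rwa [hform, hlσ', zero_mul, zero_mul, add_zero] at this
  have hcases : l ⬝ᵥ extScal D σ = 0 ∨ extScal D τ ⬝ᵥ q = 0 := by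
    simpa using hlστ 1
  rcases hcases with hlσ | hτq
  · filter_upwards [hU z] with t ht
    rw [resolvent_left hM ht, ← hq, hc, zero_sub, ← hl, hform, hlσ, hlσ']
    simp
  -- the remaining case: the deviation is quadratic in the direction `z`
  have hg : ∀ z : D, ∀ᶠ t : K in cofinite, e ⬝ᵥ (Ring.inverse (M + t • (z • W)) *ᵥ c) =
      (t * t) • (l ⬝ᵥ extScal D σ * z *
        (extScal D τ ⬝ᵥ (Ring.inverse (M + t • (z • W)) *ᵥ extScal D σ')) * z *
          (extScal D τ' ⬝ᵥ q)) := fun z => by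
    filter_upwards [hU z] with t ht
    rw [resolvent_right hM ht, ← hq, hc, zero_sub, hform, hτq, mul_zero, zero_add,
      ← dotProduct_mulVec, resolvent_left hM ht, ← hl, hform, hlσ', zero_mul, zero_mul, add_zero,
      dotProduct_mulVec, ← hl, hlσ', zero_sub, mul_smul]
    simp only [neg_mul, smul_neg, neg_neg, smul_mul_assoc]
  have hlim : ∀ z : D, ∃ κ : K, l ⬝ᵥ extScal D σ * z *
        (extScal D τ ⬝ᵥ (Ring.inverse M *ᵥ extScal D σ')) * z *
          (extScal D τ' ⬝ᵥ q) = κ • (e ⬝ᵥ (Ring.inverse M *ᵥ f)) := fun z => by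
    set n₀ := fun t : K => extScal D τ ⬝ᵥ (Ring.inverse (M + t • (z • W)) *ᵥ extScal D σ')
    have hn : PencilFun n₀ := pencilFun_inverse hM (z • W) (extScal D τ) (extScal D σ')
    have hn' : PencilFun fun t : K => l ⬝ᵥ extScal D σ * z * n₀ t * (z * (extScal D τ' ⬝ᵥ q)) := by
      have := pencilFun_inverse (K := K) hM (z • W) ((l ⬝ᵥ extScal D σ * z) • extScal D τ) (extScal D σ')
      have := this.mul_const (z * (extScal D τ' ⬝ᵥ q))
      simpa only [smul_dotProduct, smul_eq_mul] using this
    have := hn'.exists_smul_eq hZ (pencilFun_inverse hM (z • W) e f) (by simpa using hf) (by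
      filter_upwards [h z, hg z, eventually_ne_zero_cofinite] with t ⟨κ, hκ⟩ hgt ht0
      refine ⟨(t * t)⁻¹ * κ, ?_⟩
      rw [mul_smul, ← hκ, hgt, smul_smul, inv_mul_cancel₀ (mul_ne_zero ht0 ht0), one_smul,
        ← mul_assoc])
    simpa [n₀, ← mul_assoc] using this
  rcases gpi_square hZ hNC hf hlim with h0 | h0 | h0
  · filter_upwards [hg z] with t ht
    rw [ht, h0]
    simp
  · set w := extScal D τ ⬝ᵥ (Ring.inverse M *ᵥ extScal D σ) * z with hw
    have h1 : ∀ᶠ t : K in cofinite, 1 + t • w ≠ 0 := by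
      rw [eventually_cofinite]
      refine Set.Subsingleton.finite fun t ht t' ht' => ?_
      simp only [ne_eq, not_not, Set.mem_ofPred_eq] at ht ht'
      have hw0 : w ≠ 0 := by
        intro hw0
        rw [hw0, smul_zero, add_zero] at ht
        exact one_ne_zero ht
      exact smul_left_injective K hw0 (add_left_cancel (ht.trans ht'.symm))
    filter_upwards [hg z, h1, hU z] with t ht ht1 hUt
    have h2 : (1 + t • w) *
        (extScal D τ ⬝ᵥ (Ring.inverse (M + t • (z • W)) *ᵥ extScal D σ')) = 0 := by
      have h3 := resolvent_left hM hUt (extScal D τ) (extScal D σ')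
      rw [h0, zero_sub, hform, ← dotProduct_mulVec, ← dotProduct_mulVec, h0, zero_mul, zero_mul,
        add_zero, ← hw] at h3
      rw [add_mul, one_mul, smul_mul_assoc]
      exact add_eq_zero_iff_eq_neg.2 h3
    rw [ht, (mul_eq_zero.1 h2).resolve_left ht1]
    simp
  · filter_upwards [hg z] with t ht
    rw [ht, h0]
    simp

end Core

section Factor

variable {D : Type*} [DivisionRing D]

lemma exists_smaller_factor {n s : ℕ} {A : Matrix (Fin n) (Fin n) D}
    {F : Matrix (Fin n) (Fin s) D} {G : Matrix (Fin s) (Fin n) D} (h : IsUnit (A + F * G))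
    (hne : G * Ring.inverse (A + F * G) * F ≠ 1) :
    ∃ s' < s, ∃ (F' : Matrix (Fin n) (Fin s') D) (G' : Matrix (Fin s') (Fin n) D),
      IsUnit (A + F' * G') := by
  obtain _ | s := s
  · exact absurd (Subsingleton.elim _ _) hne
  set M := A + F * G with hM
  set E := 1 - G * Ring.inverse M * F with hE
  have hE0 : ∃ j k, E j k ≠ 0 := by
    by_contra! hc
    exact hne (sub_eq_zero.1 (Matrix.ext hc : E = 0)).symm
  obtain ⟨k, r, hrk, hr⟩ : ∃ (k : Fin (s + 1)) (r : Fin (s + 1) → D), r k = 1 ∧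
      r ⬝ᵥ (fun j => E j k) ≠ 0 := by
    obtain ⟨j, k, hjk⟩ := hE0
    by_cases hkk : E k k = 0
    · have hne : k ≠ j := by rintro rfl; exact hjk hkk
      refine ⟨k, Pi.single k 1 + Pi.single j 1, by simp [hne], ?_⟩
      rw [add_dotProduct, single_dotProduct, single_dotProduct]
      simpa [hkk] using hjk
    · exact ⟨k, Pi.single k 1, by simp, by simpa using hkk⟩
  set f : Fin n → D := fun i => F i k
  set P : Matrix (Fin (s + 1)) (Fin (s + 1)) D := 1 - vecMulVec (Pi.single k 1) r with hP
  have hreg : LeftRegular (A + F * P * G) := by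
    intro v hv
    have e1 : A + F * P * G = M - vecMulVec f (r ᵥ* G) := by
      have : F * vecMulVec (Pi.single k 1) r * G = vecMulVec f (r ᵥ* G) := by
        rw [Matrix.mul_vecMulVec, Matrix.vecMulVec_mul]
        congr 1
        ext i
        simp [f]
      rw [hM, hP, Matrix.mul_sub, Matrix.mul_one, Matrix.sub_mul, this]
      abel
    have e2 : v ᵥ* M = (v ⬝ᵥ f) • (r ᵥ* G) := by
      rw [e1, Matrix.vecMul_sub, sub_eq_zero] at hv
      rw [hv]
      ext i
      simp [vecMul, vecMulVec_apply, dotProduct, Finset.sum_mul, mul_assoc]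
    have e3 : v = (v ⬝ᵥ f) • (r ᵥ* (G * Ring.inverse M)) := by
      have := congrArg (· ᵥ* Ring.inverse M) e2
      simpa only [Matrix.vecMul_vecMul, Ring.mul_inverse_cancel _ h, Matrix.vecMul_one,
        Matrix.smul_vecMul] using this
    have e4 : r ⬝ᵥ (fun j => E j k) = 1 - (r ᵥ* (G * Ring.inverse M)) ⬝ᵥ f := by
      rw [← dotProduct_mulVec]
      have : (fun j => E j k) = Pi.single k 1 - (G * Ring.inverse M) *ᵥ f := by
        ext j
        simp [hE, Matrix.one_apply, Pi.single_apply, Matrix.mul_apply, mulVec, dotProduct, f]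
      rw [this, dotProduct_sub, dotProduct_single, hrk, mul_one]
    have e5 : (v ⬝ᵥ f) * (r ⬝ᵥ (fun j => E j k)) = 0 := by
      have e6 := congrArg (· ⬝ᵥ f) e3
      simp only [smul_dotProduct, smul_eq_mul] at e6
      rw [e4, mul_sub, mul_one, sub_eq_zero]
      exact e6
    rw [e3, (mul_eq_zero.1 e5).resolve_right hr, zero_smul]
  refine ⟨s, Nat.lt_succ_self s, (F * P).submatrix id k.succAbove, G.submatrix k.succAbove id, ?_⟩
  have : (F * P).submatrix id k.succAbove * G.submatrix k.succAbove id = F * P * G := by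
    ext i j
    have hz : (F * P) i k = 0 := by
      rw [hP, Matrix.mul_sub, Matrix.mul_one, Matrix.mul_vecMulVec]
      simp [vecMulVec_apply, hrk]
    rw [Matrix.mul_apply, Matrix.mul_apply (M := F * P), Fin.sum_univ_succAbove _ k, hz]
    simp
  rw [this]
  exact hreg.isUnit

end Factor

section Dimension

variable {K D : Type*} [Field K] [DivisionRing D] [Algebra K D]

lemma exists_right_inverse_of_linearIndependent {n r : ℕ} {v : Fin r → Fin n → K}
    (hv : LinearIndependent K v) : ∃ W : Matrix (Fin n) (Fin r) K, of v * W = 1 := by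
  have hinj : Function.Injective (of v).vecMulLinear := by
    have := Matrix.vecMul_injective_iff (M := of v)
    exact this.2 hv
  obtain ⟨g, hg⟩ := LinearMap.exists_leftInverse_of_injective _ (LinearMap.ker_eq_bot.2 hinj)
  refine ⟨LinearMap.toMatrix' g |>.transpose, ?_⟩
  have h1 : ∀ x : Fin r → K, g (x ᵥ* of v) = x := fun x => LinearMap.congr_fun hg x
  ext i j
  have h2 := congrFun (h1 (Pi.single i 1)) j
  rw [Matrix.single_one_vecMul] at h2
  rw [Matrix.mul_apply_eq_vecMul, Matrix.vecMul_transpose, LinearMap.toMatrix'_mulVec]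
  rw [Matrix.one_apply]
  change g ((of v).row i) j = _
  rw [h2, Pi.single_apply]
  simp [eq_comm]

lemma map_right_inverse {n r : ℕ} {v : Fin r → Fin n → K} {W : Matrix (Fin n) (Fin r) K}
    (hW : of v * W = 1) :
    (of v).map (algebraMap K D) * W.map (algebraMap K D) = 1 := by
  rw [← Matrix.map_mul, hW, Matrix.map_one _ (map_zero _) (map_one _)]

lemma finrank_le_of_extScal_mem {n : ℕ} {T : Submodule K (Fin n → K)}
    {T' : Submodule D (Fin n → D)} (h : ∀ c ∈ T, extScal D c ∈ T') :
    Module.finrank K T ≤ Module.finrank D T' := by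
  let v : Fin (Module.finrank K T) → Fin n → K := fun i => (Module.finBasis K T i : Fin n → K)
  have hv : LinearIndependent K v :=
    (Module.finBasis K T).linearIndependent.map' T.subtype T.ker_subtype
  obtain ⟨W, hW⟩ := exists_right_inverse_of_linearIndependent hv
  have hW' := map_right_inverse (D := D) hW
  have hli : LinearIndependent D fun i => (⟨extScal D (v i), h _ (Module.finBasis K T i).2⟩ : T') := by
    rw [Fintype.linearIndependent_iff]
    intro g hg i
    have h1 : g ᵥ* (of v).map (algebraMap K D) = 0 := by
      have := congrArg Subtype.val hg
      rw [Submodule.coe_sum] at this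
      ext j
      have := congrFun this j
      simpa [vecMul, dotProduct, extScal] using this
    have h2 := congrArg (· ᵥ* W.map (algebraMap K D)) h1
    simp only [Matrix.vecMul_vecMul, hW', Matrix.vecMul_one, Matrix.zero_vecMul] at h2
    exact congrFun h2 i
  simpa using hli.fintype_card_le_finrank

/-- The left `D`-subspace of row vectors vanishing on a `K`-subspace. -/
def perpScal (D : Type*) [DivisionRing D] [Algebra K D] {n : ℕ} (S : Submodule K (Fin n → K)) :
    Submodule D (Fin n → D) where
  carrier := {w | ∀ c ∈ S, w ⬝ᵥ extScal D c = 0}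
  add_mem' := fun hx hy c hc => by rw [add_dotProduct, hx c hc, hy c hc, add_zero]
  zero_mem' := fun c _ => zero_dotProduct _
  smul_mem' := fun d x hx c hc => by rw [smul_dotProduct, hx c hc, smul_zero]

lemma finrank_perpScal_add_le {n : ℕ} (S : Submodule K (Fin n → K)) :
    Module.finrank D (perpScal D S) + Module.finrank K S ≤ n := by
  let v : Fin (Module.finrank K S) → Fin n → K := fun i => (Module.finBasis K S i : Fin n → K)
  have hv : LinearIndependent K v :=
    (Module.finBasis K S).linearIndependent.map' S.subtype S.ker_subtype
  obtain ⟨W, hW⟩ := exists_right_inverse_of_linearIndependent hv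
  have hW' : (Wᵀ).map (algebraMap K D) * ((of v)ᵀ).map (algebraMap K D) = 1 := by
    rw [← Matrix.map_mul, ← Matrix.transpose_mul, hW, Matrix.transpose_one,
      Matrix.map_one _ (map_zero _) (map_one _)]
  let φ := (((of v)ᵀ).map (algebraMap K D)).vecMulLinear
  have hsurj : Function.Surjective φ := fun x =>
    ⟨x ᵥ* (Wᵀ).map (algebraMap K D), by
      change (x ᵥ* (Wᵀ).map (algebraMap K D)) ᵥ* (((of v)ᵀ).map (algebraMap K D)) = _
      rw [Matrix.vecMul_vecMul, hW', Matrix.vecMul_one]⟩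
  have h1 := φ.finrank_range_add_finrank_ker
  rw [LinearMap.range_eq_top.2 hsurj, finrank_top] at h1
  simp only [Module.finrank_fin_fun] at h1
  have h2 : perpScal D S ≤ LinearMap.ker φ := by
    intro w hw
    rw [LinearMap.mem_ker]
    ext i
    exact hw (v i) (Module.finBasis K S i).2
  have h3 := Submodule.finrank_mono h2
  omega

lemma extScal_mem_perpScal {n : ℕ} {S : Submodule K (Fin n → K)} {w : Fin n → K}
    (h : ∀ c ∈ S, w ⬝ᵥ c = 0) : extScal D w ∈ perpScal D S := by
  intro c hc
  have := congrArg (algebraMap K D) (h c hc)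
  simpa [dotProduct, extScal] using this

end Dimension

section Covering

open Filter

variable {K : Type*} [Field K]

/-- A pair of subspaces such that every line `⟨aᵢ, bᵢ⟩` is contained in one of the two subspaces
or meets both of them. -/
def IsCoveringPair {n m : ℕ} (a b : Fin m → Fin n → K) (S T : Submodule K (Fin n → K)) : Prop :=
  ∀ i, (a i ∈ S ∧ b i ∈ S) ∨ (a i ∈ T ∧ b i ∈ T) ∨
    ((∃ μ₁ μ₂ : K, (μ₁ ≠ 0 ∨ μ₂ ≠ 0) ∧ μ₁ • a i + μ₂ • b i ∈ S) ∧
      (∃ μ₁ μ₂ : K, (μ₁ ≠ 0 ∨ μ₂ ≠ 0) ∧ μ₁ • a i + μ₂ • b i ∈ T))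

variable {D : Type*} [DivisionRing D] [Algebra K D]

/-- The value of the linear matrix with coefficients `aᵢ ∧ bᵢ` at a point over `D`. -/
def linVal {n m : ℕ} (a b : Fin m → Fin n → K) (x : Fin m → D) : Matrix (Fin n) (Fin n) D :=
  ∑ i, x i • wedgeScal D (a i) (b i)

/-- The point `x + t z eⱼ` on the line through `x` in direction `z eⱼ`. -/
def linePt {m : ℕ} (x : Fin m → D) (j : Fin m) (z : D) (t : K) : Fin m → D :=
  x + t • (Pi.single j z : Fin m → D)

@[simp] lemma linePt_zero {m : ℕ} (x : Fin m → D) (j : Fin m) (z : D) :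
    linePt x j z (0 : K) = x := by
  simp [linePt]

lemma linVal_update {n m : ℕ} (a b : Fin m → Fin n → K) (x : Fin m → D) (j : Fin m) (z : D)
    (t : K) :
    linVal a b (linePt x j z t) = linVal a b x + t • (z • wedgeScal D (a j) (b j)) := by
  simp only [linVal, linePt, Pi.add_apply, Pi.smul_apply, add_smul, Finset.sum_add_distrib]
  congr 1
  rw [Finset.sum_eq_single j]
  · rw [Pi.single_eq_same, smul_assoc]
  · intro i _ hij
    rw [Pi.single_eq_of_ne hij, smul_zero, zero_smul]
  · simp

/-- A row space complement: the rows of `G (A(x) + F G)⁻¹`. -/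
def rowMat {n m s : ℕ} (a b : Fin m → Fin n → K) (F : Matrix (Fin n) (Fin s) D)
    (G : Matrix (Fin s) (Fin n) D) (x : Fin m → D) : Matrix (Fin s) (Fin n) D :=
  G * Ring.inverse (linVal a b x + F * G)

lemma rowMat_mulVec {n m s : ℕ} (a b : Fin m → Fin n → K) (F : Matrix (Fin n) (Fin s) D)
    (G : Matrix (Fin s) (Fin n) D) (x : Fin m → D) (v : Fin n → D) (p : Fin s) :
    (rowMat a b F G x *ᵥ v) p = G p ⬝ᵥ (Ring.inverse (linVal a b x + F * G) *ᵥ v) := by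
  rw [rowMat, ← Matrix.mulVec_mulVec]
  rfl

section Line

variable {n m s : ℕ} {a b : Fin m → Fin n → K} {F : Matrix (Fin n) (Fin s) D}
  {G : Matrix (Fin s) (Fin n) D} {x : Fin m → D}

lemma linVal_line (j : Fin m) (z : D) (t : K) :
    linVal a b (linePt x j z t) + F * G =
      (linVal a b x + F * G) + t • (z • wedgeScal D (a j) (b j)) := by
  rw [linVal_update]; abel

lemma pencilFun_rowMat (hx : IsUnit (linVal a b x + F * G)) (j : Fin m) (z : D) (v : Fin n → D)
    (p : Fin s) : PencilFun fun t : K => (rowMat a b F G (linePt x j z t) *ᵥ v) p := by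
  simp only [rowMat_mulVec, linVal_line]
  exact pencilFun_inverse hx _ _ _

lemma eventually_isUnit_line (hx : IsUnit (linVal a b x + F * G)) (j : Fin m) (z : D) :
    ∀ᶠ t : K in cofinite, IsUnit (linVal a b (linePt x j z t) + F * G) := by
  simp only [linVal_line]
  exact (hx.eventually_pencil _).filter_mono le_sup_left

lemma eventually_rowMat_ne_zero (hx : IsUnit (linVal a b x + F * G)) (j : Fin m) (z : D)
    {v : Fin n → D} {p : Fin s} (hv : (rowMat a b F G x *ᵥ v) p ≠ 0) :
    ∀ᶠ t : K in cofinite, (rowMat a b F G (linePt x j z t) *ᵥ v) p ≠ 0 :=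
  (pencilFun_rowMat hx j z v p).eventually_ne_zero (by simpa using hv)

end Line

/-- The row matrix kills a nontrivial `K`-combination of `aᵢ` and `bᵢ`. -/
def KillsPoint {n s : ℕ} (H : Matrix (Fin s) (Fin n) D) (a b : Fin n → K) : Prop :=
  ∃ μ₁ μ₂ : K, (μ₁ ≠ 0 ∨ μ₂ ≠ 0) ∧ H *ᵥ extScal D (μ₁ • a + μ₂ • b) = 0

/-- The row matrix kills the line spanned by `aᵢ` and `bᵢ`. -/
def KillsLine {n s : ℕ} (H : Matrix (Fin s) (Fin n) D) (a b : Fin n → K) : Prop :=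
  H *ᵥ extScal D a = 0 ∧ H *ᵥ extScal D b = 0

lemma mulVec_extScal_comb {n s : ℕ} (H : Matrix (Fin s) (Fin n) D) (a b : Fin n → K) (μ₁ μ₂ : K) :
    H *ᵥ extScal D (μ₁ • a + μ₂ • b) = μ₁ • (H *ᵥ extScal D a) + μ₂ • (H *ᵥ extScal D b) := by
  rw [extScal_comb, Matrix.mulVec_add, Matrix.mulVec_smul, Matrix.mulVec_smul]

lemma KillsPoint.cross {n s : ℕ} {H : Matrix (Fin s) (Fin n) D} {a b : Fin n → K}
    (h : KillsPoint H a b) (p r : Fin s) (z : D) :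
    (H *ᵥ extScal D a) p * z * (H *ᵥ extScal D b) r -
      (H *ᵥ extScal D b) p * z * (H *ᵥ extScal D a) r = 0 := by
  obtain ⟨μ₁, μ₂, hμ, h⟩ := h
  rw [mulVec_extScal_comb] at h
  rcases hμ with hμ | hμ
  · have : H *ᵥ extScal D a = (-(μ₁⁻¹ * μ₂)) • (H *ᵥ extScal D b) := by
      rw [neg_smul, mul_smul, ← smul_neg, ← eq_neg_of_add_eq_zero_left h, smul_smul,
        inv_mul_cancel₀ hμ, one_smul]
    rw [this]
    simp
  · have : H *ᵥ extScal D b = (-(μ₂⁻¹ * μ₁)) • (H *ᵥ extScal D a) := by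
      rw [neg_smul, mul_smul, ← smul_neg, ← eq_neg_of_add_eq_zero_right h, smul_smul,
        inv_mul_cancel₀ hμ, one_smul]
    rw [this]
    simp

lemma killsPoint_of_cross (hZ : CentralScalars K D) {n s : ℕ} {H : Matrix (Fin s) (Fin n) D}
    {a b : Fin n → K} (h : ∀ p r z, (H *ᵥ extScal D a) p * z * (H *ᵥ extScal D b) r -
      (H *ᵥ extScal D b) p * z * (H *ᵥ extScal D a) r = 0) : KillsPoint H a b := by
  by_cases ha : H *ᵥ extScal D a = 0
  · exact ⟨1, 0, Or.inl one_ne_zero, by rw [mulVec_extScal_comb, ha]; simp⟩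
  obtain ⟨r, hr⟩ := Function.ne_iff.1 ha
  rcases gpi_right hZ (p := (H *ᵥ extScal D a) r) (p' := -(H *ᵥ extScal D b) r)
    (q := (H *ᵥ extScal D b) r) (q' := (H *ᵥ extScal D a) r) (fun z => by
      rw [neg_mul, neg_mul, ← sub_eq_add_neg]; exact h r r z) with h1 | ⟨μ₁, μ₂, hμ, h1⟩
  · exact absurd h1.1 hr
  refine ⟨μ₂, μ₁, hμ.symm, ?_⟩
  rw [mulVec_extScal_comb]
  ext p
  have h2 := h p r 1
  simp only [mul_one] at h2
  have h3 : (μ₂ • (H *ᵥ extScal D a) p + μ₁ • (H *ᵥ extScal D b) p) * (H *ᵥ extScal D a) r = 0 := by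
    rw [add_mul, smul_mul_assoc, smul_mul_assoc, ← sub_eq_zero.1 h2, ← mul_smul_comm,
      ← mul_smul_comm, ← mul_add, add_comm, h1, mul_zero]
  exact (mul_eq_zero.1 h3).resolve_right hr

section Line

variable {n m s : ℕ} {a b : Fin m → Fin n → K} {F : Matrix (Fin n) (Fin s) D}
  {G : Matrix (Fin s) (Fin n) D} {x : Fin m → D}

lemma eventually_not_killsLine (hx : IsUnit (linVal a b x + F * G)) (j : Fin m) (z : D) {i : Fin m}
    (hi : ¬ KillsLine (rowMat a b F G x) (a i) (b i)) :
    ∀ᶠ t : K in cofinite, ¬ KillsLine (rowMat a b F G (linePt x j z t)) (a i) (b i) := by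
  rw [KillsLine, not_and_or] at hi
  rcases hi with hi | hi <;> obtain ⟨p, hp⟩ := Function.ne_iff.1 hi
  · filter_upwards [eventually_rowMat_ne_zero hx j z hp] with t ht h
    exact ht (by rw [h.1]; rfl)
  · filter_upwards [eventually_rowMat_ne_zero hx j z hp] with t ht h
    exact ht (by rw [h.2]; rfl)

lemma eventually_not_killsPoint (hZ : CentralScalars K D) (hx : IsUnit (linVal a b x + F * G))
    (j : Fin m) (z : D) {i : Fin m} (hi : ¬ KillsPoint (rowMat a b F G x) (a i) (b i)) :
    ∀ᶠ t : K in cofinite, ¬ KillsPoint (rowMat a b F G (linePt x j z t)) (a i) (b i) := by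
  have h1 := mt (killsPoint_of_cross hZ) hi
  push Not at h1
  obtain ⟨p, r, y, hne⟩ := h1
  have h2 := (((pencilFun_rowMat hx j z (extScal D (a i)) p).mul_const y).mul
    (pencilFun_rowMat hx j z (extScal D (b i)) r)).sub
    (((pencilFun_rowMat hx j z (extScal D (b i)) p).mul_const y).mul
    (pencilFun_rowMat hx j z (extScal D (a i)) r))
  filter_upwards [h2.eventually_ne_zero (by simpa using hne)] with t ht h
  exact ht (h.cross p r y)

end Line

end Covering

section Covering

open Filter

variable {K : Type*} [Field K] {D : Type*} [DivisionRing D] [Algebra K D]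

lemma KillsPoint.exists_smul {n s : ℕ} {H : Matrix (Fin s) (Fin n) D} {a b f : Fin n → K}
    (h : KillsPoint H a b) (hf : f = a ∨ f = b) (hne : H *ᵥ extScal D f ≠ 0) (μ₁ μ₂ : K) :
    ∃ κ : K, H *ᵥ extScal D (μ₁ • a + μ₂ • b) = κ • (H *ᵥ extScal D f) := by
  obtain ⟨ν₁, ν₂, hν, h⟩ := h
  rw [mulVec_extScal_comb] at h
  rcases hf with rfl | rfl
  · have hν2 : ν₂ ≠ 0 := by
      rintro rfl
      have : ν₁ ≠ 0 := by simpa using hν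
      rw [zero_smul, add_zero, smul_eq_zero] at h
      exact h.elim this hne
    refine ⟨μ₁ + μ₂ * (-(ν₂⁻¹ * ν₁)), ?_⟩
    have : H *ᵥ extScal D b = (-(ν₂⁻¹ * ν₁)) • (H *ᵥ extScal D f) := by
      rw [neg_smul, mul_smul, ← smul_neg, ← eq_neg_of_add_eq_zero_right h, smul_smul,
        inv_mul_cancel₀ hν2, one_smul]
    rw [mulVec_extScal_comb, this, add_smul, mul_smul]
  · have hν1 : ν₁ ≠ 0 := by
      rintro rfl
      have : ν₂ ≠ 0 := by simpa using hν
      rw [zero_smul, zero_add, smul_eq_zero] at h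
      exact h.elim this hne
    refine ⟨μ₁ * (-(ν₁⁻¹ * ν₂)) + μ₂, ?_⟩
    have : H *ᵥ extScal D a = (-(ν₁⁻¹ * ν₂)) • (H *ᵥ extScal D f) := by
      rw [neg_smul, mul_smul, ← smul_neg, ← eq_neg_of_add_eq_zero_left h, smul_smul,
        inv_mul_cancel₀ hν1, one_smul]
    rw [mulVec_extScal_comb, this, add_smul, mul_smul]

variable {n m s : ℕ} {a b : Fin m → Fin n → K} {F : Matrix (Fin n) (Fin s) D}
  {G : Matrix (Fin s) (Fin n) D} {x : Fin m → D}

lemma eventually_comb_killed [Infinite K] (hZ : CentralScalars K D)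
    (hNC : ∃ x y : D, x * y ≠ y * x) (hx : IsUnit (linVal a b x + F * G))
    (hP : ∀ i j z, KillsPoint (rowMat a b F G x) (a i) (b i) →
      ∀ᶠ t : K in cofinite, KillsPoint (rowMat a b F G (linePt x j z t)) (a i) (b i))
    (hL : ∀ i j z, KillsLine (rowMat a b F G x) (a i) (b i) →
      ∀ᶠ t : K in cofinite, KillsLine (rowMat a b F G (linePt x j z t)) (a i) (b i))
    {i : Fin m} {μ₁ μ₂ : K} (hμ : μ₁ ≠ 0 ∨ μ₂ ≠ 0)
    (hk : rowMat a b F G x *ᵥ extScal D (μ₁ • a i + μ₂ • b i) = 0) (j : Fin m) (z : D) :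
    ∀ᶠ t : K in cofinite,
      rowMat a b F G (linePt x j z t) *ᵥ extScal D (μ₁ • a i + μ₂ • b i) = 0 := by
  by_cases hline : KillsLine (rowMat a b F G x) (a i) (b i)
  · filter_upwards [hL i j z hline] with t ht
    rw [mulVec_extScal_comb, ht.1, ht.2]
    simp
  obtain ⟨f, hf, p, hp⟩ : ∃ f : Fin n → K, (f = a i ∨ f = b i) ∧ ∃ p,
      (rowMat a b F G x *ᵥ extScal D f) p ≠ 0 := by
    rw [KillsLine, not_and_or] at hline
    rcases hline with h | h
    · exact ⟨a i, Or.inl rfl, Function.ne_iff.1 h⟩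
    · exact ⟨b i, Or.inr rfl, Function.ne_iff.1 h⟩
  have hsm : ∀ z : D, ∀ᶠ t : K in cofinite, ∃ κ : K,
      rowMat a b F G (linePt x j z t) *ᵥ extScal D (μ₁ • a i + μ₂ • b i) =
        κ • (rowMat a b F G (linePt x j z t) *ᵥ extScal D f) := fun z => by
    filter_upwards [hP i j z ⟨μ₁, μ₂, hμ, hk⟩, eventually_rowMat_ne_zero hx j z hp] with t h1 h2
    exact h1.exists_smul hf (fun h0 => h2 (by rw [h0]; rfl)) μ₁ μ₂
  have h3 := eventually_killed hZ hNC hx (a j) (b j) (G p) (extScal D (μ₁ • a i + μ₂ • b i))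
    (extScal D f) (by rw [← rowMat_mulVec, hk]; rfl) (by rwa [← rowMat_mulVec]) (fun z => by
      filter_upwards [hsm z] with t ⟨κ, hκ⟩
      refine ⟨κ, ?_⟩
      rw [← linVal_line, ← rowMat_mulVec, ← rowMat_mulVec, hκ]
      rfl) z
  filter_upwards [h3, hsm z, eventually_rowMat_ne_zero hx j z hp] with t h4 ⟨κ, hκ⟩ h5
  rw [← linVal_line, ← rowMat_mulVec, hκ, Pi.smul_apply, smul_eq_zero] at h4
  rw [hκ, h4.resolve_right h5, zero_smul]

/-- The combinations of `aᵢ` and `bᵢ` killed by a row matrix. -/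
def killedPoints (H : Matrix (Fin s) (Fin n) D) (a b : Fin m → Fin n → K) : Set (Fin n → K) :=
  {c | ∃ i, ∃ μ₁ μ₂ : K, (μ₁ ≠ 0 ∨ μ₂ ≠ 0) ∧ c = μ₁ • a i + μ₂ • b i ∧ H *ᵥ extScal D c = 0}

lemma mem_perpScal_span {X : Set (Fin n → K)} {w : Fin n → D}
    (h : ∀ c ∈ X, w ⬝ᵥ extScal D c = 0) : w ∈ perpScal D (Submodule.span K X) := by
  intro c hc
  induction hc using Submodule.span_induction with
  | mem c hc => exact h c hc
  | zero => simp [extScal, dotProduct]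
  | add c d _ _ hc hd =>
    have := extScal_comb (D := D) c d 1 1
    rw [one_smul, one_smul, one_smul, one_smul] at this
    rw [this, dotProduct_add, hc, hd, add_zero]
  | smul κ c _ hc =>
    have := extScal_comb (D := D) c 0 κ 0
    rw [zero_smul, zero_smul, add_zero, add_zero] at this
    rw [this, dotProduct_smul, hc, smul_zero]

lemma eventually_rows_mem (hstab : ∀ {i : Fin m} {μ₁ μ₂ : K}, (μ₁ ≠ 0 ∨ μ₂ ≠ 0) →
    rowMat a b F G x *ᵥ extScal D (μ₁ • a i + μ₂ • b i) = 0 → ∀ (j : Fin m) (z : D),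
    ∀ᶠ t : K in cofinite,
      rowMat a b F G (linePt x j z t) *ᵥ extScal D (μ₁ • a i + μ₂ • b i) = 0)
    (j : Fin m) (z : D) : ∀ᶠ t : K in cofinite, ∀ p, rowMat a b F G (linePt x j z t) p ∈
      perpScal D (Submodule.span K (killedPoints (rowMat a b F G x) a b)) := by
  obtain ⟨X, hX, hspan, hli⟩ := exists_linearIndependent K (killedPoints (rowMat a b F G x) a b)
  have hfin : X.Finite := hli.setFinite
  have h1 : ∀ c ∈ X, ∀ᶠ t : K in cofinite,
      rowMat a b F G (linePt x j z t) *ᵥ extScal D c = 0 := by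
    intro c hc
    obtain ⟨i, μ₁, μ₂, hμ, rfl, hk⟩ := hX hc
    exact hstab hμ hk j z
  filter_upwards [(eventually_all_finite hfin).2 h1] with t ht p
  rw [← hspan]
  exact mem_perpScal_span fun c hc => congrFun (ht c hc) p

lemma vecMul_wedgeScal (w : Fin n → D) (a b : Fin n → K) :
    w ᵥ* wedgeScal D a b = (w ⬝ᵥ extScal D a) • extScal D b - (w ⬝ᵥ extScal D b) • extScal D a := by
  ext i
  simp [wedgeScal, vecMul, dotProduct, extScal, mul_sub, Finset.sum_mul, vecMulVec_apply,
    mul_assoc]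

lemma exists_dual_separating {S : Submodule K (Fin n → K)} {v : Fin n → K} (hv : v ∉ S) :
    ∃ w : Fin n → K, w ⬝ᵥ v ≠ 0 ∧ ∀ c ∈ S, w ⬝ᵥ c = 0 := by
  obtain ⟨f, hf, hS⟩ := Submodule.exists_le_ker_of_notMem hv
  have hfw : ∀ c, (fun i => f (Pi.single i 1)) ⬝ᵥ c = f c := fun c => by
    conv_rhs => rw [← Finset.univ_sum_single c, map_sum]
    refine Finset.sum_congr rfl fun i _ => ?_
    have : Pi.single i (c i) = c i • (Pi.single i 1 : Fin n → K) := by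
      rw [← Pi.single_smul, smul_eq_mul, mul_one]
    rw [this, map_smul, smul_eq_mul, mul_comm]
  exact ⟨fun i => f (Pi.single i 1), by rwa [hfw], fun c hc => by rw [hfw]; exact hS hc⟩

lemma isCoveringPair_of_image {S T : Submodule K (Fin n → K)} {T' : Submodule D (Fin n → D)}
    (hT : ∀ c, c ∈ T ↔ extScal D c ∈ T')
    (hT' : ∀ i, ∀ w ∈ perpScal D S, w ᵥ* wedgeScal D (a i) (b i) ∈ T') :
    IsCoveringPair a b S T := by
  have himg : ∀ i, ∀ w : Fin n → K, (∀ c ∈ S, w ⬝ᵥ c = 0) →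
      (-(w ⬝ᵥ b i)) • a i + (w ⬝ᵥ a i) • b i ∈ T := by
    intro i w hw
    rw [hT]
    convert hT' i _ (extScal_mem_perpScal hw) using 1
    have hd : ∀ c : Fin n → K, extScal D w ⬝ᵥ extScal D c = algebraMap K D (w ⬝ᵥ c) := fun c => by
      simp [dotProduct, extScal]
    rw [vecMul_wedgeScal, extScal_comb, hd, hd, neg_smul, algebraMap_smul, algebraMap_smul]
    abel
  intro i
  by_cases h1 : a i ∈ S ∧ b i ∈ S
  · exact Or.inl h1
  right
  by_cases h2 : ∃ μ₁ μ₂ : K, (μ₁ ≠ 0 ∨ μ₂ ≠ 0) ∧ μ₁ • a i + μ₂ • b i ∈ S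
  · right
    refine ⟨h2, ?_⟩
    rw [not_and_or] at h1
    rcases h1 with h1 | h1 <;> obtain ⟨w, hw, hwS⟩ := exists_dual_separating h1
    · exact ⟨_, _, Or.inr hw, himg i w hwS⟩
    · exact ⟨_, _, Or.inl (neg_ne_zero.2 hw), himg i w hwS⟩
  · left
    push Not at h2
    have key : ∀ μ : K, a i + μ • b i ∉ S := fun μ => by
      simpa using h2 1 μ (Or.inl one_ne_zero)
    have hb : b i ∉ S := by simpa using h2 0 1 (Or.inr one_ne_zero)
    obtain ⟨w, hw, hwS⟩ := exists_dual_separating hb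
    obtain ⟨w', hw', hwS'⟩ := exists_dual_separating (key (-(w ⬝ᵥ b i)⁻¹ * (w ⬝ᵥ a i)))
    have e1 := himg i w hwS
    have e2 := himg i w' hwS'
    have hdet : (w' ⬝ᵥ a i) * (w ⬝ᵥ b i) - (w' ⬝ᵥ b i) * (w ⬝ᵥ a i) ≠ 0 := by
      rw [dotProduct_add, dotProduct_smul, smul_eq_mul] at hw'
      intro h0
      apply hw'
      field_simp
      linear_combination h0
    set δ := (w' ⬝ᵥ a i) * (w ⬝ᵥ b i) - (w' ⬝ᵥ b i) * (w ⬝ᵥ a i) with hδ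
    constructor
    · have e3 : a i = δ⁻¹ • ((w ⬝ᵥ a i) • ((-(w' ⬝ᵥ b i)) • a i + (w' ⬝ᵥ a i) • b i) -
          (w' ⬝ᵥ a i) • ((-(w ⬝ᵥ b i)) • a i + (w ⬝ᵥ a i) • b i)) := by
        rw [eq_inv_smul_iff₀ hdet, hδ]
        module
      rw [e3]
      exact T.smul_mem _ (T.sub_mem (T.smul_mem _ e2) (T.smul_mem _ e1))
    · have e3 : b i = δ⁻¹ • ((w ⬝ᵥ b i) • ((-(w' ⬝ᵥ b i)) • a i + (w' ⬝ᵥ a i) • b i) -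
          (w' ⬝ᵥ b i) • ((-(w ⬝ᵥ b i)) • a i + (w ⬝ᵥ a i) • b i)) := by
        rw [eq_inv_smul_iff₀ hdet, hδ]
        module
      rw [e3]
      exact T.smul_mem _ (T.sub_mem (T.smul_mem _ e2) (T.smul_mem _ e1))

end Covering

section Covering

open Filter

variable {K : Type*} [Field K] {D : Type*} [DivisionRing D] [Algebra K D]

variable {n m s : ℕ} {a b : Fin m → Fin n → K} {F : Matrix (Fin n) (Fin s) D}
  {G : Matrix (Fin s) (Fin n) D} {x : Fin m → D}

lemma dotProduct_wedgeScal_eq_zero (hZ : CentralScalars K D) {H : Matrix (Fin s) (Fin n) D}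
    {v : Fin n → D} {j : Fin m}
    (h : ∀ p (z : D), H p ⬝ᵥ ((z • wedgeScal D (a j) (b j)) *ᵥ v) = 0) {w : Fin n → D}
    (hw : w ∈ perpScal D (Submodule.span K (killedPoints H a b))) :
    w ⬝ᵥ (wedgeScal D (a j) (b j) *ᵥ v) = 0 := by
  have hmem : ∀ μ₁ μ₂ : K, (μ₁ ≠ 0 ∨ μ₂ ≠ 0) →
      (∀ p, H p ⬝ᵥ extScal D (μ₁ • a j + μ₂ • b j) = 0) →
      μ₁ • (w ⬝ᵥ extScal D (a j)) + μ₂ • (w ⬝ᵥ extScal D (b j)) = 0 := by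
    intro μ₁ μ₂ hμ hk
    have := hw _ (Submodule.subset_span ⟨j, μ₁, μ₂, hμ, rfl, funext hk⟩)
    rwa [extScal_comb, dotProduct_add, dotProduct_smul, dotProduct_smul] at this
  have hform := form_wedgeScal (a j) (b j) w v 1
  rw [one_smul, mul_one, mul_one] at hform
  rw [hform]
  by_cases hall : ∀ p, H p ⬝ᵥ extScal D (a j) = 0 ∧ H p ⬝ᵥ extScal D (b j) = 0
  · have h1 := hmem 1 0 (by simp) (fun p => by simpa using (hall p).1)
    have h2 := hmem 0 1 (by simp) (fun p => by simpa using (hall p).2)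
    simp only [one_smul, zero_smul, add_zero, zero_add] at h1 h2
    rw [h1, h2]
    simp
  push Not at hall
  obtain ⟨p, hp⟩ := hall
  simp only [form_wedgeScal] at h
  rcases gpi_right hZ (h p) with ⟨h1, h2⟩ | ⟨μ₁, μ₂, hμ | hμ, hd⟩
  · exact absurd (by simpa using h2) (hp h1)
  · set β := extScal D (b j) ⬝ᵥ v
    set α := extScal D (a j) ⬝ᵥ v
    have hβ : β = (-(μ₁⁻¹ * μ₂)) • α := by
      rw [neg_smul, mul_smul, ← smul_neg, ← eq_neg_of_add_eq_zero_left hd, smul_smul,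
        inv_mul_cancel₀ hμ, one_smul]
    set κ := -(μ₁⁻¹ * μ₂)
    by_cases hα : α = 0
    · rw [hβ, hα]; simp
    have h3 := hmem κ (-1) (by simp) (fun q => by
      have := h q 1
      rw [hβ, mul_one, mul_one, mul_smul_comm, ← smul_mul_assoc, ← add_mul] at this
      rw [extScal_comb, dotProduct_add, dotProduct_smul, dotProduct_smul, neg_smul (1 : K), one_smul]
      exact (mul_eq_zero.1 this).resolve_right hα)
    rw [hβ, mul_smul_comm, ← smul_mul_assoc, ← add_mul]
    rw [neg_smul (1 : K), one_smul] at h3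
    rw [h3, zero_mul]
  · set β := extScal D (b j) ⬝ᵥ v
    set α := extScal D (a j) ⬝ᵥ v
    have hβ : α = (-(μ₂⁻¹ * μ₁)) • β := by
      rw [neg_smul, mul_smul, ← smul_neg, ← eq_neg_of_add_eq_zero_right hd, smul_smul,
        inv_mul_cancel₀ hμ, one_smul]
    set κ := -(μ₂⁻¹ * μ₁)
    by_cases hα : β = 0
    · rw [hβ, hα]; simp
    have h3 := hmem 1 (-κ) (by simp) (fun q => by
      have := h q 1
      rw [hβ, mul_one, mul_one, mul_smul_comm, ← smul_mul_assoc, ← add_mul] at this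
      rw [extScal_comb, dotProduct_add, dotProduct_smul, dotProduct_smul, neg_smul, one_smul,
        ← smul_neg]
      exact (mul_eq_zero.1 this).resolve_right hα)
    rw [hβ, mul_smul_comm, ← smul_mul_assoc, ← add_mul]
    rw [neg_smul, one_smul, ← smul_neg] at h3
    rw [h3, zero_mul]

lemma rowMat_mul_linVal (hx : IsUnit (linVal a b x + F * G)) (h1 : rowMat a b F G x * F = 1) :
    rowMat a b F G x * linVal a b x = 0 := by
  have : rowMat a b F G x * (linVal a b x + F * G) = G := by
    rw [rowMat, Matrix.mul_assoc, Ring.inverse_mul_cancel _ hx, Matrix.mul_one]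
  rwa [Matrix.mul_add, ← Matrix.mul_assoc, h1, Matrix.one_mul, add_eq_right] at this

lemma finrank_map_add_le {U : Submodule D (Fin n → D)} {A : Matrix (Fin n) (Fin n) D}
    {H : Matrix (Fin s) (Fin n) D} (hU : ∀ p, H p ∈ U) (hHA : H * A = 0) (hHF : H * F = 1) :
    Module.finrank D (U.map A.vecMulLinear) + s ≤ Module.finrank D U := by
  set ψ := A.vecMulLinear.domRestrict U
  have h1 := ψ.finrank_range_add_finrank_ker
  have h2 : LinearMap.range ψ = U.map A.vecMulLinear := LinearMap.range_domRestrict _ _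
  rw [h2] at h1
  have hker : ∀ p, (⟨H p, hU p⟩ : U) ∈ LinearMap.ker ψ := fun p => by
    rw [LinearMap.mem_ker]
    change H p ᵥ* A = 0
    rw [← Matrix.mul_apply_eq_vecMul, hHA]
    rfl
  have hH : LinearIndependent D H.row := by
    refine Fintype.linearIndependent_iff.2 fun g hg i => ?_
    have h3 : g ᵥ* H = 0 := by
      ext j
      have := congrFun hg j
      simpa [vecMul, dotProduct] using this
    have h4 := congrArg (· ᵥ* F) h3
    simp only [Matrix.vecMul_vecMul, hHF, Matrix.vecMul_one, Matrix.zero_vecMul] at h4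
    exact congrFun h4 i
  let fam : Fin s → LinearMap.ker ψ := fun p => ⟨⟨H p, hU p⟩, hker p⟩
  have hli : LinearIndependent D fam :=
    LinearIndependent.of_comp (U.subtype ∘ₗ (LinearMap.ker ψ).subtype) hH
  have h5 := hli.fintype_card_le_finrank
  rw [Fintype.card_fin] at h5
  omega

lemma exists_dotProduct_eq {f : (Fin n → D) →ₗ[D] D} : ∃ v, ∀ w, f w = w ⬝ᵥ v := by
  refine ⟨fun i => f (Pi.single i 1), fun w => ?_⟩
  conv_lhs => rw [← Finset.univ_sum_single w, map_sum]
  refine Finset.sum_congr rfl fun i _ => ?_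
  have : Pi.single i (w i) = w i • (Pi.single i 1 : Fin n → D) := by
    rw [← Pi.single_smul, smul_eq_mul, mul_one]
  rw [this, map_smul, smul_eq_mul]

lemma exists_stable_point (hZ : CentralScalars K D) (hne : ∃ x, IsUnit (linVal a b x + F * G)) :
    ∃ x, IsUnit (linVal a b x + F * G) ∧
      (∀ i j z, KillsPoint (rowMat a b F G x) (a i) (b i) →
        ∀ᶠ t : K in cofinite, KillsPoint (rowMat a b F G (linePt x j z t)) (a i) (b i)) ∧
      (∀ i j z, KillsLine (rowMat a b F G x) (a i) (b i) →
        ∀ᶠ t : K in cofinite, KillsLine (rowMat a b F G (linePt x j z t)) (a i) (b i)) := by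
  classical
  let P : (Fin m → D) → Finset (Fin m) := fun x =>
    Finset.univ.filter fun i => KillsPoint (rowMat a b F G x) (a i) (b i)
  let L : (Fin m → D) → Finset (Fin m) := fun x =>
    Finset.univ.filter fun i => KillsLine (rowMat a b F G x) (a i) (b i)
  obtain ⟨x, hx, hmin⟩ := (measure fun x => (P x).card + (L x).card).wf.has_min
    {x | IsUnit (linVal a b x + F * G)} hne
  have key : ∀ j z, ∀ᶠ t : K in cofinite, P (linePt x j z t) = P x ∧ L (linePt x j z t) = L x := by
    intro j z
    have h1 : ∀ᶠ t : K in cofinite, P (linePt x j z t) ⊆ P x := by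
      have : ∀ i, ∀ᶠ t : K in cofinite, i ∈ P (linePt x j z t) → i ∈ P x := fun i => by
        by_cases hi : i ∈ P x
        · exact Eventually.of_forall fun _ _ => hi
        · filter_upwards [eventually_not_killsPoint hZ hx j z (i := i) (by simpa [P] using hi)]
            with t ht h
          exact absurd (by simpa [P] using h) ht
      exact (eventually_all.2 this).mono fun t ht i => ht i
    have h2 : ∀ᶠ t : K in cofinite, L (linePt x j z t) ⊆ L x := by
      have : ∀ i, ∀ᶠ t : K in cofinite, i ∈ L (linePt x j z t) → i ∈ L x := fun i => by
        by_cases hi : i ∈ L x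
        · exact Eventually.of_forall fun _ _ => hi
        · filter_upwards [eventually_not_killsLine hx j z (i := i) (by simpa [L] using hi)]
            with t ht h
          exact absurd (by simpa [L] using h) ht
      exact (eventually_all.2 this).mono fun t ht i => ht i
    filter_upwards [h1, h2, eventually_isUnit_line hx j z] with t hP hL hu
    have h3 := hmin _ hu
    have h4 : ¬ ((P (linePt x j z t)).card + (L (linePt x j z t)).card <
      (P x).card + (L x).card) := h3
    have h5 := Finset.card_le_card hP
    have h6 := Finset.card_le_card hL
    exact ⟨Finset.eq_of_subset_of_card_le hP (by omega),
      Finset.eq_of_subset_of_card_le hL (by omega)⟩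
  refine ⟨x, hx, fun i j z hi => ?_, fun i j z hi => ?_⟩
  · filter_upwards [key j z] with t ht
    have : i ∈ P (linePt x j z t) := by rw [ht.1]; simpa [P] using hi
    simpa [P] using this
  · filter_upwards [key j z] with t ht
    have : i ∈ L (linePt x j z t) := by rw [ht.2]; simpa [L] using hi
    simpa [L] using this

theorem exists_coveringPair [Infinite K] (hZ : CentralScalars K D)
    (hNC : ∃ x y : D, x * y ≠ y * x) (a b : Fin m → Fin n → K) :
    ∃ (s : ℕ) (x : Fin m → D) (F : Matrix (Fin n) (Fin s) D) (G : Matrix (Fin s) (Fin n) D),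
      IsUnit (linVal a b x + F * G) ∧ ∃ S T : Submodule K (Fin n → K), IsCoveringPair a b S T ∧
        Module.finrank K S + Module.finrank K T + s ≤ n := by
  classical
  have hex : ∃ s, ∃ (x : Fin m → D) (F : Matrix (Fin n) (Fin s) D) (G : Matrix (Fin s) (Fin n) D),
      IsUnit (linVal a b x + F * G) := ⟨n, 0, 1, 1, by simp [linVal]⟩
  obtain ⟨s, ⟨x₀, F, G, hx₀⟩, hsmin⟩ : ∃ s, (∃ (x : Fin m → D) (F : Matrix (Fin n) (Fin s) D)
      (G : Matrix (Fin s) (Fin n) D), IsUnit (linVal a b x + F * G)) ∧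
      ∀ s' < s, ¬ ∃ (x : Fin m → D) (F : Matrix (Fin n) (Fin s') D)
        (G : Matrix (Fin s') (Fin n) D), IsUnit (linVal a b x + F * G) :=
    ⟨Nat.find hex, Nat.find_spec hex, fun _ h => Nat.find_min hex h⟩
  obtain ⟨x, hx, hP, hL⟩ := exists_stable_point hZ ⟨x₀, hx₀⟩
  have hone : ∀ x, IsUnit (linVal a b x + F * G) → rowMat a b F G x * F = 1 := by
    intro x hx
    by_contra hne
    obtain ⟨s', hs', F', G', hu⟩ := exists_smaller_factor hx hne
    exact hsmin s' hs' ⟨x, F', G', hu⟩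
  set H := rowMat a b F G x with hH
  set S := Submodule.span K (killedPoints H a b) with hS
  set U := perpScal D S with hU
  have hrows := eventually_rows_mem fun {i μ₁ μ₂} hμ hk =>
    eventually_comb_killed hZ hNC hx hP hL (i := i) (μ₁ := μ₁) (μ₂ := μ₂) hμ hk
  have hrow : ∀ p, H p ∈ U := fun p =>
    mem_perpScal_span fun c ⟨_, _, _, _, _, hc⟩ => congrFun hc p
  set T' : Submodule D (Fin n → D) :=
    Submodule.span D {y | ∃ j, ∃ w ∈ U, y = w ᵥ* wedgeScal D (a j) (b j)} with hT'
  have hle : T' ≤ U.map (linVal a b x).vecMulLinear := by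
    intro y hy
    by_contra hyn
    obtain ⟨f, hfy, hf⟩ := Submodule.exists_le_ker_of_notMem hyn
    obtain ⟨v, hv⟩ := exists_dotProduct_eq (f := f)
    have h1 : ∀ w ∈ U, w ⬝ᵥ (linVal a b x *ᵥ v) = 0 := fun w hw => by
      rw [dotProduct_mulVec, ← hv]
      exact hf ⟨w, hw, rfl⟩
    have h2 : ∀ j p (z : D), H p ⬝ᵥ ((z • wedgeScal D (a j) (b j)) *ᵥ v) = 0 := by
      intro j p z
      have h3 := (pencilFun_rowMat hx j z ((z • wedgeScal D (a j) (b j)) *ᵥ v) p).eq_zero (K := K)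
      rw [linePt_zero] at h3
      apply h3
      filter_upwards [hrows j z, eventually_isUnit_line hx j z, eventually_ne_zero_cofinite]
        with t ht hu ht0
      have h4 := rowMat_mul_linVal hu (hone _ hu)
      have h5 : rowMat a b F G (linePt x j z t) p ⬝ᵥ (linVal a b (linePt x j z t) *ᵥ v) = 0 := by
        rw [dotProduct_mulVec, ← Matrix.mul_apply_eq_vecMul, h4]
        exact zero_dotProduct _
      rw [linVal_update, Matrix.add_mulVec, dotProduct_add, h1 _ (ht p), zero_add,
        Matrix.smul_mulVec, dotProduct_smul, smul_eq_zero] at h5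
      exact h5.resolve_left ht0
    have h3 : T' ≤ LinearMap.ker f := by
      rw [hT', Submodule.span_le]
      rintro _ ⟨j, w, hw, rfl⟩
      rw [SetLike.mem_coe, LinearMap.mem_ker, hv, ← dotProduct_mulVec]
      exact dotProduct_wedgeScal_eq_zero hZ (h2 j) hw
    exact hfy (h3 hy)
  let T : Submodule K (Fin n → K) :=
    { carrier := {c | extScal D c ∈ T'}
      add_mem' := fun {c d} hc hd => by
        have := extScal_comb (D := D) c d 1 1
        rw [one_smul, one_smul, one_smul, one_smul] at this
        rw [Set.mem_ofPred_eq, this]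
        exact T'.add_mem hc hd
      zero_mem' := by
        have : extScal D (0 : Fin n → K) = 0 := by funext i; simp [extScal]
        rw [Set.mem_ofPred_eq, this]
        exact T'.zero_mem
      smul_mem' := fun κ c hc => by
        have : extScal D (κ • c) = algebraMap K D κ • extScal D c := by
          funext i; simp [extScal]
        rw [Set.mem_ofPred_eq, this]
        exact T'.smul_mem _ hc }
  refine ⟨s, x, F, G, hx, S, T, isCoveringPair_of_image (T' := T') (fun c => Iff.rfl)
    (fun i w hw => Submodule.subset_span ⟨i, w, hw, rfl⟩), ?_⟩
  have h1 : Module.finrank K T ≤ Module.finrank D T' := finrank_le_of_extScal_mem fun c hc => hc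
  have h2 := Submodule.finrank_mono hle
  have h3 := finrank_map_add_le hrow (rowMat_mul_linVal hx (hone x hx)) (hone x hx)
  have h4 := finrank_perpScal_add_le (D := D) S
  rw [← hU] at h4
  omega

end Covering

section Specialization

open LaurentSeries

universe u

variable {k L E : Type*} [Field k] [Field L] [Field E]

/-- Subspaces over `E` can be specialised along `φ : k →+* E` without raising the dimension,
keeping the `k`-rational vectors and the rational lines they meet. -/
def SpecializesAlong (φ : k →+* E) : Prop :=
  ∀ (n : ℕ) (S : Submodule E (Fin n → E)), ∃ S₀ : Submodule k (Fin n → k),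
    Module.finrank k S₀ ≤ Module.finrank E S ∧ (∀ v : Fin n → k, φ ∘ v ∈ S → v ∈ S₀) ∧
    ∀ (a b : Fin n → k) (f₁ f₂ : E), (f₁ ≠ 0 ∨ f₂ ≠ 0) → f₁ • (φ ∘ a) + f₂ • (φ ∘ b) ∈ S →
      ∃ c₁ c₂ : k, (c₁ ≠ 0 ∨ c₂ ≠ 0) ∧ c₁ • a + c₂ • b ∈ S₀

lemma SpecializesAlong.comp {φ : k →+* L} {ψ : L →+* E} (hφ : SpecializesAlong φ) (hψ : SpecializesAlong ψ) :
    SpecializesAlong (ψ.comp φ) := by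
  intro n S
  obtain ⟨S₁, h1, h2, h3⟩ := hψ n S
  obtain ⟨S₀, h4, h5, h6⟩ := hφ n S₁
  refine ⟨S₀, h4.trans h1, fun v hv => h5 v (h2 _ hv), fun a b f₁ f₂ hf hS => ?_⟩
  obtain ⟨c₁, c₂, hc, hc'⟩ := h3 (φ ∘ a) (φ ∘ b) f₁ f₂ hf hS
  exact h6 a b c₁ c₂ hc hc'

lemma SpecializesAlong.of_comp {φ : k →+* L} {ψ : L →+* E} (h : SpecializesAlong (ψ.comp φ)) :
    SpecializesAlong φ := by
  intro n S
  let S' : Submodule E (Fin n → E) := Submodule.span E {u | ∃ v ∈ S, u = ψ ∘ v}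
  have hS' : Module.finrank E S' ≤ Module.finrank L S := by
    let bS := Module.finBasis L S
    have hle : S' ≤ Submodule.span E (Set.range fun i => ψ ∘ ((bS i : S) : Fin n → L)) := by
      refine Submodule.span_le.2 ?_
      rintro _ ⟨v, hv, rfl⟩
      have hsum : v = ∑ i, bS.repr ⟨v, hv⟩ i • ((bS i : S) : Fin n → L) := by
        have h := congrArg Subtype.val (bS.sum_repr ⟨v, hv⟩)
        rw [Submodule.coe_sum] at h
        exact h.symm
      have : ψ ∘ v = ∑ i, ψ (bS.repr ⟨v, hv⟩ i) • (ψ ∘ ((bS i : S) : Fin n → L)) := by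
        conv_lhs => rw [hsum]
        funext j
        simp [Finset.sum_apply]
      rw [SetLike.mem_coe, this]
      exact Submodule.sum_mem _ fun i _ =>
        Submodule.smul_mem _ _ (Submodule.subset_span ⟨i, rfl⟩)
    refine (Submodule.finrank_mono hle).trans ((finrank_range_le_card _).trans ?_)
    rw [Fintype.card_fin]
  obtain ⟨S₀, h1, h2, h3⟩ := h n S'
  refine ⟨S₀, h1.trans hS', fun v hv => h2 v (Submodule.subset_span ⟨_, hv, rfl⟩),
    fun a b f₁ f₂ hf hS => h3 a b (ψ f₁) (ψ f₂) (by simpa using hf)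
      (Submodule.subset_span ⟨_, hS, ?_⟩)⟩
  funext j
  simp

lemma exists_primitive_laurentSeries {ι : Type*} [Fintype ι] (f : ι → k⸨X⸩) (hf : ∃ i, f i ≠ 0) :
    ∃ c : k⸨X⸩, c ≠ 0 ∧ ∃ p : ι → PowerSeries k,
      (∀ i, f i = c * HahnSeries.ofPowerSeries ℤ k (p i)) ∧
      ∃ i, PowerSeries.constantCoeff (p i) ≠ 0 := by
  classical
  obtain ⟨i₀, hi₀⟩ := hf
  obtain ⟨j, hj, hmin⟩ := (Finset.univ.filter fun i => f i ≠ 0).exists_min_image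
    (fun i => (f i).order) ⟨i₀, by simpa using hi₀⟩
  have hj0 : f j ≠ 0 := by simpa using hj
  refine ⟨HahnSeries.single (f j).order 1, by simp,
    fun i => PowerSeries.X ^ ((f i).order - (f j).order).toNat * (f i).powerSeriesPart,
    fun i => ?_, j, ?_⟩
  · by_cases hi : f i = 0
    · simp [hi]
    have hle := hmin i (by simpa using hi)
    rw [map_mul, HahnSeries.ofPowerSeries_X_pow, ← mul_assoc, HahnSeries.single_mul_single,
      mul_one, Int.toNat_of_nonneg (by omega), add_sub_cancel,
      LaurentSeries.single_order_mul_powerSeriesPart]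
  · beta_reduce
    rw [sub_self, Int.toNat_zero, pow_zero, one_mul, ← PowerSeries.coeff_zero_eq_constantCoeff_apply,
      LaurentSeries.powerSeriesPart_coeff, Nat.cast_zero, add_zero]
    exact fun h => hj0 (HahnSeries.coeff_order_eq_zero.1 h)

lemma specializes_laurentSeries : SpecializesAlong (HahnSeries.C : k →+* k⸨X⸩) := by
  intro n S
  let J := HahnSeries.ofPowerSeries ℤ k
  have hJ : ∀ p, J p = 0 → p = 0 := fun p hp =>
    HahnSeries.ofPowerSeries_injective (by rw [hp, map_zero] : J p = J 0)
  let S₀ : Submodule k (Fin n → k) :=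
    { carrier := {v | ∃ p : Fin n → PowerSeries k, J ∘ p ∈ S ∧ v = PowerSeries.constantCoeff ∘ p}
      add_mem' := by
        rintro _ _ ⟨p, hp, rfl⟩ ⟨q, hq, rfl⟩
        refine ⟨p + q, ?_, by funext i; simp⟩
        convert S.add_mem hp hq using 1
        funext i; simp
      zero_mem' := ⟨0, by convert S.zero_mem using 1; funext i; simp, by funext i; simp⟩
      smul_mem' := by
        rintro c _ ⟨p, hp, rfl⟩
        refine ⟨fun i => PowerSeries.C c * p i, ?_, by funext i; simp⟩
        convert S.smul_mem (J (PowerSeries.C c)) hp using 1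
        funext i; simp }
  refine ⟨S₀, ?_, fun v hv => ?_, fun a b f₁ f₂ hf hS => ?_⟩
  · let bS := Module.finBasis k S₀
    choose p hp hpb using fun i => (bS i).2
    have hli : LinearIndependent k⸨X⸩ fun i => (⟨J ∘ p i, hp i⟩ : S) := by
      by_contra hdep
      rw [Fintype.not_linearIndependent_iff] at hdep
      obtain ⟨g, hg, hne⟩ := hdep
      obtain ⟨c, hc, q, hq, i, hqi⟩ := exists_primitive_laurentSeries g hne
      have h1 : ∀ j, ∑ i, q i * p i j = 0 := by
        intro j
        have h := congrFun (congrArg Subtype.val hg) j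
        simp only [Submodule.coe_sum, Submodule.coe_smul, Finset.sum_apply, Pi.smul_apply,
          Function.comp_apply, smul_eq_mul, ZeroMemClass.coe_zero, Pi.zero_apply] at h
        apply hJ
        rw [map_sum]
        refine (mul_eq_zero.1 ?_).resolve_left hc
        rw [Finset.mul_sum, ← h]
        exact Finset.sum_congr rfl fun i _ => by rw [map_mul, ← mul_assoc, hq i]
      have h2 : ∑ i, PowerSeries.constantCoeff (q i) • bS i = 0 := by
        apply Subtype.ext
        funext j
        have h := congrArg PowerSeries.constantCoeff (h1 j)
        simp only [map_sum, map_mul, map_zero] at h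
        simp only [Submodule.coe_sum, Submodule.coe_smul, Finset.sum_apply, Pi.smul_apply,
          smul_eq_mul, ZeroMemClass.coe_zero, Pi.zero_apply]
        rw [← h]
        exact Finset.sum_congr rfl fun i _ => by rw [hpb i]; rfl
      exact hqi (Fintype.linearIndependent_iff.1 bS.linearIndependent _ h2 i)
    simpa using hli.fintype_card_le_finrank
  · refine ⟨fun i => PowerSeries.C (v i), ?_, by funext i; simp⟩
    convert hv using 1
    funext i
    exact HahnSeries.ofPowerSeries_C _
  · obtain ⟨c, hc, q, hq, hqi⟩ := exists_primitive_laurentSeries ![f₁, f₂] (by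
      rcases hf with h | h
      · exact ⟨0, h⟩
      · exact ⟨1, h⟩)
    refine ⟨PowerSeries.constantCoeff (q 0), PowerSeries.constantCoeff (q 1), ?_,
      fun i => q 0 * PowerSeries.C (a i) + q 1 * PowerSeries.C (b i), ?_, by funext i; simp⟩
    · obtain ⟨i, hi⟩ := hqi
      fin_cases i
      · exact Or.inl hi
      · exact Or.inr hi
    · have h0 : f₁ = c * J (q 0) := hq 0
      have h1 : f₂ = c * J (q 1) := hq 1
      convert S.smul_mem c⁻¹ hS using 1
      funext i
      have hC : ∀ r, J (PowerSeries.C r) = HahnSeries.C r := HahnSeries.ofPowerSeries_C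
      simp only [Function.comp_apply, Pi.smul_apply, Pi.add_apply, smul_eq_mul, h0, h1, map_add,
        map_mul, hC]
      field_simp

lemma specializes_id : SpecializesAlong (RingHom.id k) := fun _ S =>
  ⟨S, le_rfl, fun _ h => h, fun _ _ f₁ f₂ hf h => ⟨f₁, f₂, hf, h⟩⟩

lemma exists_specializes_mvPolynomial (d : ℕ) (k : Type u) [Field k] :
    ∃ (E : Type u) (_ : Field E) (φ : MvPolynomial (Fin d) k →+* E),
      Function.Injective φ ∧ SpecializesAlong (φ.comp MvPolynomial.C) := by
  induction d with
  | zero =>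
    refine ⟨k, inferInstance, (MvPolynomial.isEmptyRingEquiv k (Fin 0)).toRingHom,
      (MvPolynomial.isEmptyRingEquiv k (Fin 0)).injective, ?_⟩
    convert specializes_id (k := k)
    ext x
    have h := (MvPolynomial.isEmptyRingEquiv k (Fin 0)).apply_symm_apply x
    rwa [MvPolynomial.isEmptyRingEquiv_symm_apply] at h
  | succ d ih =>
    obtain ⟨E, _, φ, hφ, hs⟩ := ih
    let ψ : MvPolynomial (Fin (d + 1)) k →+* E⸨X⸩ :=
      ((HahnSeries.ofPowerSeries ℤ E).comp Polynomial.coeToPowerSeries.ringHom).comp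
        ((Polynomial.mapRingHom φ).comp (MvPolynomial.finSuccEquiv k d).toRingEquiv.toRingHom)
    refine ⟨E⸨X⸩, inferInstance, ψ, ?_, ?_⟩
    · refine (HahnSeries.ofPowerSeries_injective.comp (Polynomial.coe_injective E)).comp
        ((Polynomial.map_injective φ hφ).comp (MvPolynomial.finSuccEquiv k d).injective)
    · convert hs.comp (specializes_laurentSeries (k := E)) using 1
      ext x
      simp [ψ, MvPolynomial.finSuccEquiv_apply]

lemma specializes_fractionRing (d : ℕ) (k : Type*) [Field k] :
    SpecializesAlong ((algebraMap (MvPolynomial (Fin d) k)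
      (FractionRing (MvPolynomial (Fin d) k))).comp MvPolynomial.C) := by
  obtain ⟨E, _, φ, hφ, hs⟩ := exists_specializes_mvPolynomial d k
  refine SpecializesAlong.of_comp (ψ := IsFractionRing.lift hφ) ?_
  convert hs using 1
  ext x
  simp

lemma SpecializesAlong.isCoveringPair {φ : k →+* E} (h : SpecializesAlong φ) {n m : ℕ}
    {a b : Fin m → Fin n → k} {S T : Submodule E (Fin n → E)}
    (hST : IsCoveringPair (fun i => φ ∘ a i) (fun i => φ ∘ b i) S T) :
    ∃ S₀ T₀ : Submodule k (Fin n → k), IsCoveringPair a b S₀ T₀ ∧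
      Module.finrank k S₀ ≤ Module.finrank E S ∧ Module.finrank k T₀ ≤ Module.finrank E T := by
  obtain ⟨S₀, h1, h2, h3⟩ := h n S
  obtain ⟨T₀, h4, h5, h6⟩ := h n T
  refine ⟨S₀, T₀, fun i => ?_, h1, h4⟩
  rcases hST i with ⟨ha, hb⟩ | ⟨ha, hb⟩ | ⟨⟨μ₁, μ₂, hμ, hS⟩, ⟨ν₁, ν₂, hν, hT⟩⟩
  · exact Or.inl ⟨h2 _ ha, h2 _ hb⟩
  · exact Or.inr (Or.inl ⟨h5 _ ha, h5 _ hb⟩)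
  · exact Or.inr (Or.inr ⟨h3 _ _ _ _ hμ hS, h6 _ _ _ _ hν hT⟩)

end Specialization

section CyclicAlgebra

open LaurentSeries

variable {k L : Type*} [Field k] [Field L] {e : ℕ}

/-- The coefficientwise action of a ring homomorphism on Laurent series. -/
def laurentMap (σ : L →+* L) : L⸨X⸩ →+* L⸨X⸩ where
  toFun f := f.map σ
  map_one' := HahnSeries.map_one σ.toMonoidWithZeroHom
  map_mul' _ _ := HahnSeries.map_mul σ.toNonUnitalRingHom
  map_zero' := HahnSeries.map_zero σ.toMonoidWithZeroHom.toZeroHom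
  map_add' _ _ := HahnSeries.map_add σ.toAddMonoidHom

lemma laurentMap_single (σ : L →+* L) (g : ℤ) (x : L) :
    laurentMap σ (HahnSeries.single g x) = HahnSeries.single g (σ x) :=
  HahnSeries.map_single (a := g) (r := x) σ.toMonoidWithZeroHom.toZeroHom

lemma order_laurentMap (σ : L →+* L) (f : L⸨X⸩) : (laurentMap σ f).order = f.order := by
  by_cases hf : f = 0
  · rw [hf, map_zero]
  have hc : (laurentMap σ f).coeff f.order ≠ 0 := by
    change σ (f.coeff f.order) ≠ 0
    rwa [Ne, map_eq_zero, HahnSeries.coeff_order_eq_zero]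
  refine le_antisymm (HahnSeries.order_le_of_coeff_ne_zero hc)
    (HahnSeries.order_le_of_coeff_ne_zero fun h => ?_)
  have h0 : (laurentMap σ f).coeff (laurentMap σ f).order = 0 := by
    change σ (f.coeff _) = 0
    rw [h, map_zero]
  rw [HahnSeries.coeff_order_eq_zero] at h0
  exact hf ((map_eq_zero _).1 h0)

/-- The weights of the cyclic shift: the uniformiser at the last index and `1` elsewhere. -/
def cyclicWeight (L : Type*) [Field L] (i : Fin (e + 1)) : L⸨X⸩ :=
  if i = Fin.last e then HahnSeries.single 1 1 else 1

lemma cyclicWeight_ne_zero (i : Fin (e + 1)) : cyclicWeight L i ≠ 0 := by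
  unfold cyclicWeight
  split_ifs <;> simp

lemma order_cyclicWeight (i : Fin (e + 1)) :
    (cyclicWeight L i).order = if i = Fin.last e then 1 else 0 := by
  unfold cyclicWeight
  split_ifs <;> simp

lemma laurentMap_cyclicWeight (σ : L →+* L) (i : Fin (e + 1)) :
    laurentMap σ (cyclicWeight L i) = cyclicWeight L i := by
  unfold cyclicWeight
  split_ifs
  · rw [laurentMap_single, map_one]
  · rw [map_one]

/-- The weighted cyclic shift matrix. -/
def cyclicShift (L : Type*) [Field L] (e : ℕ) : Matrix (Fin (e + 1)) (Fin (e + 1)) L⸨X⸩ :=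
  Matrix.of fun i j => if i = j + 1 then cyclicWeight L j else 0

lemma cyclicShift_mul_apply (M : Matrix (Fin (e + 1)) (Fin (e + 1)) L⸨X⸩) (i j) :
    (cyclicShift L e * M) (i + 1) j = cyclicWeight L i * M i j := by
  simp [Matrix.mul_apply, cyclicShift]

lemma mul_cyclicShift_apply (M : Matrix (Fin (e + 1)) (Fin (e + 1)) L⸨X⸩) (i j) :
    (M * cyclicShift L e) i j = M i (j + 1) * cyclicWeight L j := by
  simp [Matrix.mul_apply, cyclicShift]

lemma cyclicShift_map (σ : L →+* L) : (cyclicShift L e).map (laurentMap σ) = cyclicShift L e := by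
  ext1 i j
  simp only [cyclicShift, Matrix.map_apply, Matrix.of_apply]
  split_ifs
  · exact laurentMap_cyclicWeight σ j
  · exact map_zero _

/-- The matrices commuting with the semilinear cyclic shift: the cyclic algebra
`(L / Lᵟ, σ, X)` in its regular representation. -/
def cyclicSubring (σ : L →+* L) (e : ℕ) : Subring (Matrix (Fin (e + 1)) (Fin (e + 1)) L⸨X⸩) where
  carrier := {M | cyclicShift L e * M.map (laurentMap σ) = M * cyclicShift L e}
  mul_mem' {M N} hM hN := by
    rw [Set.mem_ofPred_eq] at *
    rw [Matrix.map_mul, ← Matrix.mul_assoc, hM, Matrix.mul_assoc, hN, Matrix.mul_assoc]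
  one_mem' := by
    rw [Set.mem_ofPred_eq, Matrix.map_one _ (map_zero _) (map_one _), Matrix.mul_one,
      Matrix.one_mul]
  add_mem' {M N} hM hN := by
    rw [Set.mem_ofPred_eq] at *
    rw [Matrix.map_add _ (map_add (laurentMap σ)), Matrix.mul_add, hM, hN, Matrix.add_mul]
  zero_mem' := by
    rw [Set.mem_ofPred_eq, Matrix.map_zero _ (map_zero _), Matrix.mul_zero, Matrix.zero_mul]
  neg_mem' {M} hM := by
    rw [Set.mem_ofPred_eq] at *
    have : (-M).map (laurentMap σ) = -(M.map (laurentMap σ)) := by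
      ext1 i j
      exact map_neg (laurentMap σ) _
    rw [this, Matrix.mul_neg, hM, Matrix.neg_mul]

variable {σ : L →+* L}

lemma mem_cyclicSubring_iff {M : Matrix (Fin (e + 1)) (Fin (e + 1)) L⸨X⸩} :
    M ∈ cyclicSubring σ e ↔ cyclicShift L e * M.map (laurentMap σ) = M * cyclicShift L e :=
  Iff.rfl

lemma cyclicSubring_apply {M : Matrix (Fin (e + 1)) (Fin (e + 1)) L⸨X⸩}
    (hM : M ∈ cyclicSubring σ e) (i j) :
    cyclicWeight L i * laurentMap σ (M i j) = M (i + 1) (j + 1) * cyclicWeight L j := by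
  have := congrFun (congrFun (mem_cyclicSubring_iff.1 hM) (i + 1)) j
  rwa [cyclicShift_mul_apply, mul_cyclicShift_apply] at this

/-- The slope weight of an entry, invariant under the diagonal shift. -/
def slopeWeight (M : Matrix (Fin (e + 1)) (Fin (e + 1)) L⸨X⸩) (i j : Fin (e + 1)) : ℤ :=
  (e + 1) * (M i j).order + i - j

lemma slopeWeight_succ {M : Matrix (Fin (e + 1)) (Fin (e + 1)) L⸨X⸩}
    (hM : M ∈ cyclicSubring σ e) {i j} (h : M i j ≠ 0) :
    M (i + 1) (j + 1) ≠ 0 ∧ slopeWeight M (i + 1) (j + 1) = slopeWeight M i j := by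
  have h1 := cyclicSubring_apply hM i j
  have hσ : laurentMap σ (M i j) ≠ 0 := (map_ne_zero _).2 h
  have h0 : M (i + 1) (j + 1) ≠ 0 := by
    intro h2
    rw [h2, zero_mul] at h1
    exact mul_ne_zero (cyclicWeight_ne_zero i) hσ h1
  refine ⟨h0, ?_⟩
  have h2 := congrArg HahnSeries.order h1
  rw [HahnSeries.order_mul (cyclicWeight_ne_zero i) hσ,
    HahnSeries.order_mul h0 (cyclicWeight_ne_zero j), order_laurentMap, order_cyclicWeight,
    order_cyclicWeight] at h2
  have hval : ∀ i : Fin (e + 1),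
      (((i + 1 : Fin (e + 1)) : ℕ) : ℤ) = i + 1 - (e + 1) * (if i = Fin.last e then 1 else 0) := by
    intro i
    rw [Fin.val_add_one]
    split_ifs with hi
    · rw [hi]; simp
    · simp
  rw [slopeWeight, slopeWeight, hval, hval]
  linear_combination -(e + 1 : ℤ) * h2

lemma slopeWeight_add {M : Matrix (Fin (e + 1)) (Fin (e + 1)) L⸨X⸩}
    (hM : M ∈ cyclicSubring σ e) {i j} (h : M i j ≠ 0) (t : Fin (e + 1)) :
    M (i + t) (j + t) ≠ 0 ∧ slopeWeight M (i + t) (j + t) = slopeWeight M i j := by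
  induction t using Fin.induction with
  | zero => simpa using h
  | succ t ih =>
    have := slopeWeight_succ hM ih.1
    rw [← Fin.coeSucc_eq_succ, ← add_assoc, ← add_assoc]
    exact ⟨this.1, this.2.trans ih.2⟩

lemma mulVec_ne_zero_of_mem_cyclicSubring {M : Matrix (Fin (e + 1)) (Fin (e + 1)) L⸨X⸩}
    (hM : M ∈ cyclicSubring σ e) (h0 : M ≠ 0) {z : Fin (e + 1) → L⸨X⸩} (hz : z ≠ 0) :
    M *ᵥ z ≠ 0 := by
  classical
  obtain ⟨⟨i', j'⟩, hij, hmin⟩ := (Finset.univ.filter fun p : Fin (e + 1) × Fin (e + 1) =>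
    M p.1 p.2 ≠ 0).exists_min_image (fun p => slopeWeight M p.1 p.2) (by
      by_contra hne
      rw [Finset.not_nonempty_iff_eq_empty, Finset.filter_eq_empty_iff] at hne
      exact h0 (by ext1 i j; simpa using hne (Finset.mem_univ (i, j))))
  obtain ⟨j, hj, hzmin⟩ := (Finset.univ.filter fun j : Fin (e + 1) => z j ≠ 0).exists_min_image
    (fun j => ((e + 1) * (z j).order + j : ℤ)) (by
      obtain ⟨j, hj⟩ := Function.ne_iff.1 hz
      exact ⟨j, by simpa using hj⟩)
  have hzj : z j ≠ 0 := by simpa using hj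
  obtain ⟨hne, hδ⟩ := slopeWeight_add hM (by simpa using hij) (j - j')
  rw [add_sub_cancel] at hne hδ
  set i := i' + (j - j')
  intro hMz
  have h1 := congrArg (fun f => HahnSeries.coeff f (M i j * z j).order) (congrFun hMz i)
  simp only [mulVec, dotProduct, Pi.zero_apply, HahnSeries.coeff_zero, HahnSeries.coeff_sum] at h1
  rw [Finset.sum_eq_single j ?_ (by simp), HahnSeries.coeff_order_eq_zero] at h1
  · exact mul_ne_zero hne hzj h1
  intro l _ hl
  by_cases hMl : M i l = 0
  · simp [hMl]
  by_cases hzl : z l = 0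
  · simp [hzl]
  apply HahnSeries.coeff_eq_zero_of_lt_order
  rw [HahnSeries.order_mul hne hzj, HahnSeries.order_mul hMl hzl]
  have h2 := hmin (i, l) (by simpa using hMl)
  have h3 := hzmin l (by simpa using hzl)
  replace h2 : slopeWeight M i j ≤ slopeWeight M i l := hδ.trans_le h2
  simp only [slopeWeight] at h2
  have h4 := j.isLt
  have h5 := l.isLt
  have h6 : (l : ℕ) ≠ j := fun h => hl (Fin.ext h)
  by_contra hlt
  have h7 : (e + 1 : ℤ) * ((M i l).order + (z l).order) ≤
      (e + 1) * ((M i j).order + (z j).order) :=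
    mul_le_mul_of_nonneg_left (by omega) (by positivity)
  have h8 : (e + 1 : ℤ) * ((z l).order - (z j).order) = j - l := by linarith
  have h9 : (e + 1 : ℤ) ∣ (j : ℤ) - l := ⟨_, h8.symm⟩
  have h10 := Int.eq_zero_of_abs_lt_dvd h9 (by rw [abs_lt]; omega)
  omega

lemma isUnit_or_eq_zero_cyclicSubring (M : cyclicSubring σ e) : IsUnit M ∨ M = 0 := by
  by_cases h0 : M = 0
  · exact Or.inr h0
  left
  have hdet : IsUnit (M : Matrix (Fin (e + 1)) (Fin (e + 1)) L⸨X⸩).det := by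
    rw [isUnit_iff_ne_zero]
    intro h
    obtain ⟨v, hv, hMv⟩ := Matrix.exists_mulVec_eq_zero_iff.2 h
    exact mulVec_ne_zero_of_mem_cyclicSubring M.2 (fun h => h0 (Subtype.ext h)) hv hMv
  have hinv : (M : Matrix (Fin (e + 1)) (Fin (e + 1)) L⸨X⸩)⁻¹ ∈ cyclicSubring σ e := by
    have hM := mem_cyclicSubring_iff.1 M.2
    set N := (M : Matrix (Fin (e + 1)) (Fin (e + 1)) L⸨X⸩)
    have h1 : N.map (laurentMap σ) * (N⁻¹).map (laurentMap σ) = 1 := by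
      rw [← Matrix.map_mul, Matrix.mul_nonsing_inv _ hdet,
        Matrix.map_one _ (map_zero _) (map_one _)]
    rw [mem_cyclicSubring_iff]
    calc cyclicShift L e * (N⁻¹).map (laurentMap σ)
        = N⁻¹ * (N * cyclicShift L e) * (N⁻¹).map (laurentMap σ) := by
          rw [← Matrix.mul_assoc, Matrix.nonsing_inv_mul _ hdet, Matrix.one_mul]
      _ = N⁻¹ * cyclicShift L e := by
          rw [← hM, Matrix.mul_assoc, Matrix.mul_assoc, h1, Matrix.mul_one]
  exact ⟨⟨M, ⟨_, hinv⟩, Subtype.ext (Matrix.mul_nonsing_inv _ hdet),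
    Subtype.ext (Matrix.nonsing_inv_mul _ hdet)⟩, rfl⟩

instance : Nontrivial (cyclicSubring σ e) := inferInstance

instance : DivisionRing (cyclicSubring σ e) :=
  DivisionRing.ofIsUnitOrEqZero isUnit_or_eq_zero_cyclicSubring

end CyclicAlgebra

section CyclicCenter

open LaurentSeries

universe u

variable {L : Type*} [Field L] {e : ℕ} {σ : L →+* L}

lemma laurentMap_C (x : L) : laurentMap σ (HahnSeries.C x) = HahnSeries.C (σ x) :=
  laurentMap_single σ 0 x

lemma cyclicShift_mem : cyclicShift L e ∈ cyclicSubring σ e := by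
  rw [mem_cyclicSubring_iff, cyclicShift_map]

lemma diagonal_mem_cyclicSubring {t : Fin (e + 1) → L⸨X⸩}
    (ht : ∀ i, laurentMap σ (t i) = t (i + 1)) : diagonal t ∈ cyclicSubring σ e := by
  rw [mem_cyclicSubring_iff]
  ext1 i j
  rw [Matrix.diagonal_mul, Matrix.diagonal_map (map_zero _), Matrix.mul_diagonal]
  simp only [cyclicShift, Matrix.of_apply]
  split_ifs with h
  · rw [h, ht, mul_comm]
  · simp

lemma scalar_mem_cyclicSubring {f : L⸨X⸩} (hf : laurentMap σ f = f) :
    scalar (Fin (e + 1)) f ∈ cyclicSubring σ e :=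
  diagonal_mem_cyclicSubring fun _ => hf

lemma scalar_mem_center {f : L⸨X⸩} (hf : laurentMap σ f = f) :
    (⟨_, scalar_mem_cyclicSubring hf⟩ : cyclicSubring σ e) ∈
      Subring.center (cyclicSubring σ e) := by
  rw [Subring.mem_center_iff]
  intro M
  exact Subtype.ext (Matrix.scalar_commute f (fun _ => mul_comm _ _) _).eq.symm

lemma eq_scalar_of_mem_center {t : Fin (e + 1) → L} (ht : ∀ i, σ (t i) = t (i + 1))
    (hinj : Function.Injective t) {c : cyclicSubring σ e}
    (hc : c ∈ Subring.center (cyclicSubring σ e)) :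
    (c : Matrix (Fin (e + 1)) (Fin (e + 1)) L⸨X⸩) =
      scalar (Fin (e + 1)) ((c : Matrix (Fin (e + 1)) (Fin (e + 1)) L⸨X⸩) 0 0) := by
  rw [Subring.mem_center_iff] at hc
  obtain ⟨M, hM⟩ := c
  simp only at *
  have hdiag : ∀ i j, i ≠ j → M i j = 0 := by
    intro i j hij
    have h := congrArg Subtype.val (hc ⟨diagonal (fun i => HahnSeries.C (t i)),
      diagonal_mem_cyclicSubring fun i => by rw [laurentMap_C, ht]⟩)
    have h1 := congrFun (congrFun h i) j
    simp only [Subring.coe_mul, Matrix.diagonal_mul, Matrix.mul_diagonal] at h1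
    rw [mul_comm, ← sub_eq_zero, ← mul_sub, mul_eq_zero, sub_eq_zero] at h1
    exact h1.resolve_right fun h2 => hij (hinj (HahnSeries.C_injective h2))
  have hconst : ∀ i, M i i = M 0 0 := by
    intro i
    induction i using Fin.induction with
    | zero => rfl
    | succ i ih =>
      rw [← ih, ← Fin.coeSucc_eq_succ]
      have h := congrArg Subtype.val (hc ⟨_, cyclicShift_mem⟩)
      have h1 := congrFun (congrFun h (i.castSucc + 1)) i.castSucc
      simp only [Subring.coe_mul] at h1
      rw [cyclicShift_mul_apply, mul_cyclicShift_apply, mul_comm] at h1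
      exact (mul_right_cancel₀ (cyclicWeight_ne_zero _) h1).symm
  ext1 i j
  by_cases hij : i = j
  · subst hij
    simp [hconst i]
  · simp [hij, hdiag i j hij]

/-- The scalar by which a central element acts. -/
def centerToLaurent {t : Fin (e + 1) → L} (ht : ∀ i, σ (t i) = t (i + 1))
    (hinj : Function.Injective t) : Subring.center (cyclicSubring σ e) →+* L⸨X⸩ where
  toFun c := ((c : cyclicSubring σ e) : Matrix (Fin (e + 1)) (Fin (e + 1)) L⸨X⸩) 0 0
  map_one' := rfl
  map_zero' := rfl
  map_add' _ _ := rfl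
  map_mul' c c' := by
    simp only [Subring.coe_mul]
    rw [eq_scalar_of_mem_center ht hinj c.2, eq_scalar_of_mem_center ht hinj c'.2, ← map_mul]
    simp

/-- The base field acting by constant scalars on the cyclic algebra. -/
def toCyclicCenter {k : Type*} [Field k] (φ : k →+* L) (hφ : ∀ c, σ (φ c) = φ c) :
    k →+* Subring.center (cyclicSubring σ e) :=
  have h : ∀ c, laurentMap σ (HahnSeries.C (φ c)) = HahnSeries.C (φ c) := fun c => by
    rw [laurentMap_C, hφ]
  { toFun := fun c => ⟨⟨_, scalar_mem_cyclicSubring (h c)⟩, scalar_mem_center (h c)⟩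
    map_one' := Subtype.ext (Subtype.ext (by simp))
    map_zero' := Subtype.ext (Subtype.ext (by simp))
    map_add' := fun _ _ => Subtype.ext (Subtype.ext (by simp))
    map_mul' := fun _ _ => Subtype.ext (Subtype.ext (by simp)) }

lemma infinite_center_cyclicSubring : Infinite (Subring.center (cyclicSubring σ e)) := by
  have hw : ∀ n : ℕ, laurentMap σ (HahnSeries.single (n : ℤ) 1) = HahnSeries.single (n : ℤ) 1 :=
    fun n => by rw [laurentMap_single, map_one]
  refine Infinite.of_injective (fun n : ℕ =>
    (⟨⟨_, scalar_mem_cyclicSubring (hw n)⟩, scalar_mem_center (hw n)⟩ :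
      Subring.center (cyclicSubring σ e))) fun n n' h => ?_
  have h1 : HahnSeries.single (n : ℤ) (1 : L) = HahnSeries.single (n' : ℤ) 1 := by
    simpa using congrFun (congrFun (congrArg Subtype.val (congrArg Subtype.val h)) 0) 0
  have h2 := congrArg HahnSeries.order h1
  rw [HahnSeries.order_single one_ne_zero, HahnSeries.order_single one_ne_zero] at h2
  exact_mod_cast h2

lemma exists_mul_ne_mul_cyclicSubring (he : 1 ≤ e) {t : Fin (e + 1) → L}
    (ht : ∀ i, σ (t i) = t (i + 1)) (hinj : Function.Injective t) :
    ∃ x y : cyclicSubring σ e, x * y ≠ y * x := by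
  refine ⟨⟨diagonal (fun i => HahnSeries.C (t i)),
    diagonal_mem_cyclicSubring fun i => by rw [laurentMap_C, ht]⟩, ⟨_, cyclicShift_mem⟩,
    fun h => ?_⟩
  have h1 := congrFun (congrFun (congrArg Subtype.val h) (0 + 1)) 0
  simp only [Subring.coe_mul] at h1
  rw [cyclicShift_mul_apply, mul_cyclicShift_apply, Matrix.diagonal_apply_eq,
    Matrix.diagonal_apply_eq, mul_comm] at h1
  have h2 := hinj (HahnSeries.C_injective (mul_left_cancel₀ (cyclicWeight_ne_zero _) h1))
  rw [zero_add] at h2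
  exact absurd h2 (by rw [Fin.one_eq_zero_iff]; omega)

theorem exists_divisionRing (k : Type u) [Field k] {d : ℕ} (hd : 2 ≤ d) :
    ∃ (E D Z : Type u) (_ : Field E) (_ : DivisionRing D) (_ : Field Z) (_ : Algebra Z D)
      (Φ : D →+* Matrix (Fin d) (Fin d) E) (ι : k →+* Z) (ε : Z →+* E),
      Infinite Z ∧ CentralScalars Z D ∧ (∃ x y : D, x * y ≠ y * x) ∧
      (∀ c : k, Φ (algebraMap Z D (ι c)) = scalar (Fin d) (ε (ι c))) ∧
      SpecializesAlong (ε.comp ι) := by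
  obtain ⟨e, rfl⟩ : ∃ e, d = e + 1 := ⟨d - 1, by omega⟩
  let A := MvPolynomial (Fin (e + 1)) k
  let L := FractionRing A
  have hren : Function.Injective ((algebraMap A L).comp
      (MvPolynomial.rename (R := k) fun i : Fin (e + 1) => i + 1).toRingHom) := by
    rw [RingHom.coe_comp]
    exact (IsFractionRing.injective A L).comp
      (MvPolynomial.rename_injective _ (add_left_injective 1))
  obtain ⟨σ, hσ⟩ : ∃ σ : L →+* L, ∀ p : A, σ (algebraMap A L p) =
      algebraMap A L (MvPolynomial.rename (fun i : Fin (e + 1) => i + 1) p) :=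
    ⟨IsFractionRing.lift hren, fun p => IsFractionRing.lift_algebraMap hren p⟩
  have ht : ∀ i, σ (algebraMap A L (MvPolynomial.X i)) = algebraMap A L (MvPolynomial.X (i + 1)) :=
    fun i => by rw [hσ, MvPolynomial.rename_X]
  have hinj : Function.Injective fun i => algebraMap A L (MvPolynomial.X i) :=
    (IsFractionRing.injective A L).comp MvPolynomial.X_injective
  have hσC : ∀ c : k, σ ((algebraMap A L).comp MvPolynomial.C c) =
      (algebraMap A L).comp MvPolynomial.C c :=
    fun c => by rw [RingHom.comp_apply, hσ, MvPolynomial.rename_C]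
  refine ⟨L⸨X⸩, cyclicSubring σ e, Subring.center (cyclicSubring σ e), inferInstance,
    inferInstance, inferInstance, inferInstance, (cyclicSubring σ e).subtype,
    toCyclicCenter _ hσC, centerToLaurent ht hinj, infinite_center_cyclicSubring,
    fun c hc => ⟨⟨c, Subring.mem_center_iff.2 fun x => (hc x).symm⟩, rfl⟩,
    exists_mul_ne_mul_cyclicSubring (by omega) ht hinj, fun c => ?_, ?_⟩
  · exact congrArg (scalar (Fin (e + 1))) (rfl : _ = _)
  · exact (specializes_fractionRing (e + 1) k).comp (specializes_laurentSeries (k := L))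

end CyclicCenter

section MatrixRank

variable {ι κ : Type*} [Fintype κ]

lemma Matrix.rank_add_le_rank_add_rank {F : Type*} [Field F] [Finite ι] (A B : Matrix ι κ F) :
    (A + B).rank ≤ A.rank + B.rank := by
  have h : (A + B).mulVecLin.range ≤ A.mulVecLin.range ⊔ B.mulVecLin.range := by
    rintro _ ⟨v, rfl⟩
    rw [mulVecLin_add, LinearMap.add_apply]
    exact Submodule.add_mem_sup ⟨v, rfl⟩ ⟨v, rfl⟩
  exact (Submodule.finrank_mono h).trans (Submodule.finrank_add_le_finrank_add_finrank _ _)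

lemma Matrix.exists_submatrix_linearIndependent_row {F : Type*} [Field F] [Fintype ι]
    (M : Matrix ι κ F) {r : ℕ} (hr : M.rank = r) :
    ∃ e : Fin r → ι, LinearIndependent F (M.submatrix e id).row := by
  subst hr
  rw [rank_eq_finrank_span_row]
  obtain ⟨f, hf, -, hl⟩ := Submodule.exists_fun_fin_finrank_span_eq F (Set.range M.row)
  choose e he using hf
  refine ⟨e, ?_⟩
  have : (M.submatrix e id).row = f := funext he
  rwa [this]

lemma Matrix.exists_submatrix_det_ne_zero {F : Type*} [Field F] [Fintype ι] (M : Matrix ι κ F) :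
    ∃ (e : Fin M.rank → ι) (c : Fin M.rank → κ), (M.submatrix e c).det ≠ 0 := by
  classical
  obtain ⟨e, he⟩ := M.exists_submatrix_linearIndependent_row rfl
  have hr := he.rank_matrix
  rw [Fintype.card_fin] at hr
  obtain ⟨c, hc⟩ := (M.submatrix e id)ᵀ.exists_submatrix_linearIndependent_row
    ((rank_transpose _).trans hr)
  refine ⟨e, c, fun h => ?_⟩
  have h2 : LinearIndependent F ((M.submatrix e c)ᵀ).row := hc
  rw [linearIndependent_rows_iff_isUnit, isUnit_iff_isUnit_det, det_transpose] at h2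
  exact h2.ne_zero h

/-- The generic rank of a matrix over a domain is at least the rank of any specialization. -/
lemma Matrix.rank_map_le_rank_map_algebraMap {R L E : Type*} [CommRing R] [Field L]
    [Algebra R L] [FaithfulSMul R L] [Field E] (f : R →+* E) [Fintype ι] (P : Matrix ι κ R) :
    (P.map f).rank ≤ (P.map (algebraMap R L)).rank := by
  obtain ⟨e, c, h⟩ := (P.map f).exists_submatrix_det_ne_zero
  have h1 : ((P.map f).submatrix e c).det = f (P.submatrix e c).det := by
    rw [RingHom.map_det]; rfl
  have h2 : ((P.map (algebraMap R L)).submatrix e c).det =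
      algebraMap R L (P.submatrix e c).det := by
    rw [RingHom.map_det]; rfl
  have h3 : ((P.map (algebraMap R L)).submatrix e c).det ≠ 0 := by
    rw [h2, Ne, FaithfulSMul.algebraMap_eq_zero_iff]
    rintro h0
    rw [h1, h0, map_zero] at h
    exact h rfl
  have h4 := rank_of_det_ne_zero h3
  rw [Fintype.card_fin] at h4
  exact h4.symm.trans_le (rank_submatrix_le _ _ _)

end MatrixRank

section BlockMatrices

variable {E D : Type*} [Field E] [DivisionRing D] {d : ℕ}

/-- The block matrix obtained by replacing each entry of a matrix by a `d × d` matrix. -/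
def blockMap (Φ : D →+* Matrix (Fin d) (Fin d) E) {n s : ℕ} (M : Matrix (Fin n) (Fin s) D) :
    Matrix (Fin d × Fin n) (Fin d × Fin s) E :=
  of fun u v => Φ (M u.2 v.2) u.1 v.1

variable (Φ : D →+* Matrix (Fin d) (Fin d) E) {n s t : ℕ}

lemma blockMap_mul (M : Matrix (Fin n) (Fin s) D) (N : Matrix (Fin s) (Fin t) D) :
    blockMap Φ (M * N) = blockMap Φ M * blockMap Φ N := by
  ext u v
  simp only [blockMap, of_apply, mul_apply, map_sum, map_mul, Matrix.sum_apply,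
    Fintype.sum_prod_type]
  exact Finset.sum_comm

lemma blockMap_one : blockMap Φ (1 : Matrix (Fin n) (Fin n) D) = 1 := by
  ext ⟨p, i⟩ ⟨q, j⟩
  by_cases h : i = j <;> by_cases h' : p = q <;> simp [blockMap, one_apply, h, h']

lemma blockMap_add (M N : Matrix (Fin n) (Fin s) D) :
    blockMap Φ (M + N) = blockMap Φ M + blockMap Φ N := by
  ext
  simp [blockMap]

lemma isUnit_blockMap {M : Matrix (Fin n) (Fin n) D} (hM : IsUnit M) : IsUnit (blockMap Φ M) := by
  obtain ⟨N, h1, h2⟩ := isUnit_iff_exists.1 hM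
  refine isUnit_iff_exists.2 ⟨blockMap Φ N, ?_, ?_⟩
  · rw [← blockMap_mul, h1, blockMap_one]
  · rw [← blockMap_mul, h2, blockMap_one]

lemma le_rank_blockMap {M : Matrix (Fin n) (Fin n) D} {F : Matrix (Fin n) (Fin s) D}
    {G : Matrix (Fin s) (Fin n) D} (h : IsUnit (M + F * G)) :
    d * n ≤ (blockMap Φ M).rank + d * s := by
  have h1 := rank_of_isUnit _ (isUnit_blockMap Φ h)
  rw [blockMap_add, blockMap_mul] at h1
  have h2 := rank_add_le_rank_add_rank (blockMap Φ M) (blockMap Φ F * blockMap Φ G)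
  have h3 := rank_mul_le_left (blockMap Φ F) (blockMap Φ G)
  have h4 := rank_le_card_width (blockMap Φ F)
  simp only [Fintype.card_prod, Fintype.card_fin] at h1 h4
  omega

end BlockMatrices

section BlowupRank

variable {K : Type*} [Field K] {n m : ℕ}

/-- The blow-up over the polynomial ring. -/
def blowupPoly (a b : Fin m → Fin n → K) (d : ℕ) :
    Matrix (Fin d × Fin n) (Fin d × Fin n) (MvPolynomial (Fin m × Fin d × Fin d) K) :=
  of fun u v => ∑ i, MvPolynomial.X (i, u.1, v.1) * MvPolynomial.C (wedge (a i) (b i) u.2 v.2)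

lemma blowup_eq_map (a b : Fin m → Fin n → K) (d : ℕ) :
    blowup a b d = (blowupPoly a b d).map (algebraMap _ (FF K m d)) := by
  ext u v
  simp [blowup, blowupPoly, Matrix.sum_apply, toFF]

lemma rank_eval_le_rank_blowup {E : Type*} [Field E] (a b : Fin m → Fin n → K) {d : ℕ}
    (φ : K →+* E) (x : Fin m → Matrix (Fin d) (Fin d) E) :
    (of fun u v : Fin d × Fin n => ∑ i, x i u.1 v.1 * φ (wedge (a i) (b i) u.2 v.2)).rank ≤
      (blowup a b d).rank := by
  rw [blowup_eq_map]
  refine le_trans (le_of_eq ?_) (rank_map_le_rank_map_algebraMap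
    (MvPolynomial.eval₂Hom φ fun j : Fin m × Fin d × Fin d => x j.1 j.2.1 j.2.2) _)
  congr 1
  ext u v
  simp [blowupPoly]

theorem exists_coveringPair_le_rank_blowup (a b : Fin m → Fin n → K) {d : ℕ} (hd : 2 ≤ d) :
    ∃ S T : Submodule K (Fin n → K), IsCoveringPair a b S T ∧
      d * (Module.finrank K S + Module.finrank K T) ≤ (blowup a b d).rank := by
  obtain ⟨E, D, Z, _, _, _, _, Φ, ι, ε, _, hZ, hNC, hΦ, hs⟩ := exists_divisionRing K hd
  obtain ⟨s, x, F, G, hu, S, T, hST, hdim⟩ :=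
    exists_coveringPair hZ hNC (fun i => ι ∘ a i) (fun i => ι ∘ b i)
  obtain ⟨S₀, T₀, hST₀, hS₀, hT₀⟩ := hs.of_comp.isCoveringPair hST
  refine ⟨S₀, T₀, hST₀, ?_⟩
  refine le_trans ?_ (rank_eval_le_rank_blowup a b (ε.comp ι) fun i => Φ (x i))
  have h := le_rank_blockMap Φ hu
  have hB : blockMap Φ (linVal (fun i => ι ∘ a i) (fun i => ι ∘ b i) x) =
      of fun u v : Fin d × Fin n =>
        ∑ i, Φ (x i) u.1 v.1 * (ε.comp ι) (wedge (a i) (b i) u.2 v.2) := by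
    ext u v
    have hw : ∀ i, wedgeScal D (ι ∘ a i) (ι ∘ b i) u.2 v.2 =
        algebraMap Z D (ι (wedge (a i) (b i) u.2 v.2)) := by
      intro i
      simp [wedgeScal, wedge, vecMulVec_apply]
    simp only [blockMap, of_apply, linVal, Matrix.sum_apply, Matrix.smul_apply, hw, smul_eq_mul,
      map_sum, map_mul, hΦ, scalar_apply, mul_diagonal, RingHom.comp_apply]
  rw [hB] at h
  have h' : d * (Module.finrank K S₀ + Module.finrank K T₀) + d * s ≤ d * n := by
    rw [← mul_add]; exact Nat.mul_le_mul_left _ (by omega)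
  omega

end BlowupRank

section LineDimension

open Module

variable {K : Type*} [Field K] {n m : ℕ} {a b : Fin n → K}

lemma left_mem_line (a b : Fin n → K) : a ∈ line a b :=
  Submodule.subset_span (Set.mem_insert a {b})

lemma right_mem_line (a b : Fin n → K) : b ∈ line a b :=
  Submodule.subset_span (Set.mem_insert_of_mem a rfl)

lemma finrank_line (h : LinearIndependent K ![a, b]) : finrank K (line a b) = 2 := by
  have := finrank_span_eq_card h
  rwa [Matrix.range_cons, Matrix.range_cons, Matrix.range_empty, Set.union_empty,
    Set.singleton_union, Fintype.card_fin] at this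

lemma finrank_inf_line_le (h : LinearIndependent K ![a, b]) (S : Submodule K (Fin n → K)) :
    finrank K ↥(S ⊓ line a b) ≤ 2 :=
  (Submodule.finrank_mono inf_le_right).trans (finrank_line h).le

lemma finrank_inf_line_eq_two (h : LinearIndependent K ![a, b]) {S : Submodule K (Fin n → K)}
    (ha : a ∈ S) (hb : b ∈ S) : finrank K ↥(S ⊓ line a b) = 2 := by
  have : line a b ≤ S := Submodule.span_le.2 (by rintro x (rfl | rfl) <;> assumption)
  rw [inf_eq_right.2 this, finrank_line h]

lemma mem_of_finrank_inf_line_eq_two (h : LinearIndependent K ![a, b])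
    {S : Submodule K (Fin n → K)} (hS : finrank K ↥(S ⊓ line a b) = 2) : a ∈ S ∧ b ∈ S := by
  have : S ⊓ line a b = line a b :=
    Submodule.eq_of_le_of_finrank_eq inf_le_right (hS.trans (finrank_line h).symm)
  rw [inf_eq_right] at this
  exact ⟨this (left_mem_line a b), this (right_mem_line a b)⟩

lemma one_le_finrank_inf_line (h : LinearIndependent K ![a, b]) {S : Submodule K (Fin n → K)}
    (hS : ∃ μ₁ μ₂ : K, (μ₁ ≠ 0 ∨ μ₂ ≠ 0) ∧ μ₁ • a + μ₂ • b ∈ S) :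
    1 ≤ finrank K ↥(S ⊓ line a b) := by
  obtain ⟨μ₁, μ₂, hμ, hmem⟩ := hS
  rw [Nat.one_le_iff_ne_zero, Ne, Submodule.finrank_eq_zero]
  intro h0
  have h1 : μ₁ • a + μ₂ • b ∈ S ⊓ line a b := ⟨hmem, Submodule.add_mem _
    (Submodule.smul_mem _ _ (left_mem_line a b)) (Submodule.smul_mem _ _ (right_mem_line a b))⟩
  rw [h0, Submodule.mem_bot] at h1
  have := LinearIndependent.pair_iff.1 h _ _ h1
  tauto

lemma exists_comb_mem_of_finrank_inf_line_ne_zero {S : Submodule K (Fin n → K)}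
    (hS : finrank K ↥(S ⊓ line a b) ≠ 0) :
    ∃ μ₁ μ₂ : K, (μ₁ ≠ 0 ∨ μ₂ ≠ 0) ∧ μ₁ • a + μ₂ • b ∈ S := by
  rw [Ne, Submodule.finrank_eq_zero, Submodule.eq_bot_iff] at hS
  push Not at hS
  obtain ⟨x, ⟨hxS, hxl⟩, hx0⟩ := hS
  obtain ⟨μ₁, μ₂, rfl⟩ := Submodule.mem_span_pair.1 hxl
  refine ⟨μ₁, μ₂, ?_, hxS⟩
  by_contra! hμ
  simp [hμ.1, hμ.2] at hx0

variable {a b : Fin m → Fin n → K}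

lemma IsCoveringPair.two_le_finrank_add (hab : ∀ i, LinearIndependent K ![a i, b i])
    {S T : Submodule K (Fin n → K)} (h : IsCoveringPair a b S T) (i : Fin m) :
    2 ≤ finrank K ↥(S ⊓ line (a i) (b i)) + finrank K ↥(T ⊓ line (a i) (b i)) := by
  rcases h i with h | h | h
  · rw [finrank_inf_line_eq_two (hab i) h.1 h.2]; omega
  · rw [finrank_inf_line_eq_two (hab i) h.1 h.2]; omega
  · have h1 := one_le_finrank_inf_line (hab i) h.1
    have h2 := one_le_finrank_inf_line (hab i) h.2
    omega

lemma IsFracMatching.two_mul_sum_le (hab : ∀ i, LinearIndependent K ![a i, b i])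
    {S T : Submodule K (Fin n → K)} (h : IsCoveringPair a b S T) {y : Fin m → ℝ}
    (hy : IsFracMatching a b y) : 2 * ∑ i, y i ≤ finrank K S + finrank K T := by
  refine le_trans ?_ (add_le_add (hy.2 S) (hy.2 T))
  rw [← Finset.sum_add_distrib, Finset.mul_sum]
  refine Finset.sum_le_sum fun i _ => ?_
  rw [← add_mul]
  refine mul_le_mul_of_nonneg_right ?_ (hy.1 i)
  exact_mod_cast h.two_le_finrank_add hab i

end LineDimension

section UpperBound

open Module

variable {K : Type*} [Field K] {n m : ℕ}

lemma Submodule.exists_matrix_mul_mulVec_eq (S : Submodule K (Fin n → K)) :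
    ∃ (M : Matrix (Fin n) (Fin (finrank K S)) K) (N : Matrix (Fin (finrank K S)) (Fin n) K),
      ∀ v ∈ S, (M * N) *ᵥ v = v := by
  obtain ⟨g, hg⟩ := S.subtype.exists_leftInverse_of_injective (by simp)
  let e := (finBasis K S).equivFun
  refine ⟨LinearMap.toMatrix' (S.subtype ∘ₗ e.symm.toLinearMap),
    LinearMap.toMatrix' (e.toLinearMap ∘ₗ g), fun v hv => ?_⟩
  rw [← LinearMap.toMatrix'_comp, LinearMap.toMatrix'_mulVec]
  have h : g v = ⟨v, hv⟩ := LinearMap.congr_fun hg ⟨v, hv⟩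
  simp [h]

/-- The Kronecker product with an identity matrix on the left, over the rational functions. -/
def inflate {l k : ℕ} (m d : ℕ) (M : Matrix (Fin l) (Fin k) K) :
    Matrix (Fin d × Fin l) (Fin d × Fin k) (FF K m d) :=
  kroneckerMap (· * ·) (1 : Matrix (Fin d) (Fin d) (FF K m d)) (M.map (toFF K m d))

lemma inflate_mul {l k r : ℕ} (m d : ℕ) (M : Matrix (Fin l) (Fin k) K)
    (N : Matrix (Fin k) (Fin r) K) :
    inflate m d (M * N) = inflate m d M * inflate m d N := by
  unfold inflate
  rw [Matrix.map_mul]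
  conv_lhs => rw [← Matrix.one_mul (1 : Matrix (Fin d) (Fin d) (FF K m d))]
  exact mul_kronecker_mul _ _ _ _

lemma inflate_mul_blowup_mul (a b : Fin m → Fin n → K) (d : ℕ) (M N : Matrix (Fin n) (Fin n) K) :
    inflate m d M * blowup a b d * inflate m d N = ∑ i : Fin m,
    kroneckerMap (· * ·)
      (Matrix.of fun p q : Fin d =>
        algebraMap (MvPolynomial (Fin m × Fin d × Fin d) K) (FF K m d) (MvPolynomial.X (i, p, q)))
      ((M * wedge (a i) (b i) * N).map (toFF K m d)) := by
  unfold inflate blowup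
  rw [Finset.mul_sum, Finset.sum_mul]
  refine Finset.sum_congr rfl fun i _ => ?_
  rw [Matrix.map_mul, Matrix.map_mul]
  refine Eq.trans (congrArg (· * _) (mul_kronecker_mul _ _ _ _).symm) ?_
  refine Eq.trans (mul_kronecker_mul _ _ _ _).symm ?_
  rw [Matrix.one_mul, Matrix.mul_one]

lemma inflate_one (m d : ℕ) : inflate m d (1 : Matrix (Fin n) (Fin n) K) = 1 := by
  unfold inflate
  rw [Matrix.map_one _ (map_zero _) (map_one _)]
  exact one_kronecker_one

lemma inflate_add {l k : ℕ} (m d : ℕ) (M N : Matrix (Fin l) (Fin k) K) :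
    inflate m d (M + N) = inflate m d M + inflate m d N := by
  ext
  simp [inflate, mul_add]

lemma rank_inflate_mul_le {l k : ℕ} (m d : ℕ) (M : Matrix (Fin l) (Fin k) K)
    (N : Matrix (Fin k) (Fin l) K) : (inflate m d (M * N)).rank ≤ d * k := by
  rw [inflate_mul]
  refine (rank_mul_le_left _ _).trans ((rank_le_card_width _).trans ?_)
  simp

lemma rank_blowup_le_of_vanishing (a b : Fin m → Fin n → K) (d : ℕ)
    (S T : Submodule K (Fin n → K))
    (h : ∀ i, ∀ u v : Fin n → K, (∀ s ∈ S, u ⬝ᵥ s = 0) → (∀ t ∈ T, v ⬝ᵥ t = 0) →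
      (u ⬝ᵥ a i) * (v ⬝ᵥ b i) = (u ⬝ᵥ b i) * (v ⬝ᵥ a i)) :
    (blowup a b d).rank ≤ d * (finrank K S + finrank K T) := by
  obtain ⟨M, N, hMN⟩ := S.exists_matrix_mul_mulVec_eq
  obtain ⟨M', N', hMN'⟩ := T.exists_matrix_mul_mulVec_eq
  set Q := M * N with hQ
  set R := M' * N' with hR
  have hrow : ∀ (Q : Matrix (Fin n) (Fin n) K) (S : Submodule K (Fin n → K)),
      (∀ v ∈ S, Q *ᵥ v = v) → ∀ p, ∀ s ∈ S, (1 - Q) p ⬝ᵥ s = 0 := by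
    intro Q S hQ p s hs
    have : ((1 - Q) *ᵥ s) p = 0 := by rw [sub_mulVec, hQ s hs, one_mulVec, sub_self]; rfl
    exact this
  have hzero : inflate m d (1 - Q) * blowup a b d * inflate m d (1 - R)ᵀ = 0 := by
    rw [inflate_mul_blowup_mul]
    refine Finset.sum_eq_zero fun i _ => ?_
    have : (1 - Q) * wedge (a i) (b i) * (1 - R)ᵀ = 0 := by
      rw [wedge, mul_sub, sub_mul, mul_vecMulVec, mul_vecMulVec, vecMulVec_mul, vecMulVec_mul,
        vecMul_transpose, vecMul_transpose]
      ext p q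
      have := h i ((1 - Q) p) ((1 - R) q) (hrow Q S hMN p) (hrow R T hMN' q)
      rw [Matrix.sub_apply, vecMulVec_apply, vecMulVec_apply]
      exact sub_eq_zero.2 this
    rw [this]
    ext
    simp
  have hdec : blowup a b d = inflate m d Q * blowup a b d +
      inflate m d (1 - Q) * blowup a b d * inflate m d Rᵀ := by
    have h1 : inflate m d (1 - Q) + inflate m d Q = 1 := by
      rw [← inflate_add, sub_add_cancel, inflate_one]
    have h2 : inflate m d (1 - R)ᵀ + inflate m d Rᵀ = 1 := by
      rw [← inflate_add, ← transpose_add, sub_add_cancel, transpose_one, inflate_one]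
    calc blowup a b d = (inflate m d (1 - Q) + inflate m d Q) * blowup a b d := by
          rw [h1, Matrix.one_mul]
      _ = inflate m d Q * blowup a b d + inflate m d (1 - Q) * blowup a b d *
            (inflate m d (1 - R)ᵀ + inflate m d Rᵀ) := by
          rw [h2, Matrix.mul_one, Matrix.add_mul, add_comm]
      _ = _ := by rw [Matrix.mul_add, hzero, zero_add]
  rw [hdec, mul_add]
  refine (rank_add_le_rank_add_rank _ _).trans (add_le_add ?_ ?_)
  · exact (rank_mul_le_left _ _).trans (rank_inflate_mul_le _ _ _ _)
  · refine (rank_mul_le_right _ _).trans ?_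
    rw [hR, transpose_mul, inflate_mul]
    refine (rank_mul_le_right _ _).trans ((rank_le_card_height _).trans ?_)
    simp

lemma rank_blowup_le_of_finrank_inf_line {a b : Fin m → Fin n → K}
    (hab : ∀ i, LinearIndependent K ![a i, b i]) (d : ℕ) {S T : Submodule K (Fin n → K)}
    (hTS : T ≤ S)
    (h : ∀ i, 2 ≤ finrank K ↥(S ⊓ line (a i) (b i)) + finrank K ↥(T ⊓ line (a i) (b i))) :
    (blowup a b d).rank ≤ d * (finrank K S + finrank K T) := by
  refine rank_blowup_le_of_vanishing a b d S T fun i u v hu hv => ?_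
  have h1 := h i
  have h2 := finrank_inf_line_le (hab i) S
  by_cases h3 : finrank K ↥(S ⊓ line (a i) (b i)) = 2
  · obtain ⟨ha, hb⟩ := mem_of_finrank_inf_line_eq_two (hab i) h3
    rw [hu _ ha, hu _ hb, zero_mul, zero_mul]
  · obtain ⟨μ₁, μ₂, hμ, hmem⟩ := exists_comb_mem_of_finrank_inf_line_ne_zero
      (a := a i) (b := b i) (S := T) (by omega)
    have e1 := hu _ (hTS hmem)
    have e2 := hv _ hmem
    rw [dotProduct_add, dotProduct_smul, dotProduct_smul, smul_eq_mul, smul_eq_mul] at e1 e2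
    rcases hμ with hμ | hμ
    · refine mul_left_cancel₀ hμ ?_
      linear_combination (v ⬝ᵥ b i) * e1 - (u ⬝ᵥ b i) * e2
    · refine mul_left_cancel₀ hμ ?_
      linear_combination (u ⬝ᵥ a i) * e2 - (v ⬝ᵥ a i) * e1

end UpperBound

section LinearProgramming

/-- A covering linear program with finitely many constraints and arbitrarily many variables either
has a strictly feasible solution of value less than `v`, or this is obstructed by a nonzero
nonnegative functional. -/
lemma exists_cover_or_exists_functional {σ : Type*} {m : ℕ} (c : σ → Fin m → ℝ) (r : σ → ℝ)
    (v : ℝ) :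
    (∃ l : σ →₀ ℝ, 0 ≤ l ∧ (∀ i, 1 < l.sum fun s t => t * c s i) ∧
      (l.sum fun s t => t * r s) < v) ∨
    ∃ (y : Fin m → ℝ) (κ : ℝ), 0 ≤ y ∧ 0 ≤ κ ∧ (κ = 0 → y ≠ 0) ∧
      (∀ s, ∑ i, c s i * y i ≤ κ * r s) ∧ κ * v ≤ ∑ i, y i := by
  let Λ : (σ →₀ ℝ) →ₗ[ℝ] (Fin m → ℝ) × ℝ := Finsupp.linearCombination ℝ fun s => (c s, -r s)
  let p₀ : (Fin m → ℝ) × ℝ := (fun _ => -1, v)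
  let X : Set ((Fin m → ℝ) × ℝ) := (fun p => p₀ + p) '' (⇑Λ '' Set.Ici (0 : σ →₀ ℝ))
  let O : Set ((Fin m → ℝ) × ℝ) := (Set.univ.pi fun _ => Set.Ioi 0) ×ˢ Set.Ioi 0
  have hX : Convex ℝ X := ((convex_Ici (𝕜 := ℝ) (0 : σ →₀ ℝ)).linear_image Λ).translate p₀
  have hO : Convex ℝ O := (convex_pi fun _ _ => convex_Ioi 0).prod (convex_Ioi 0)
  have hO' : IsOpen O := (isOpen_set_pi Set.finite_univ fun _ _ => isOpen_Ioi).prod isOpen_Ioi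
  by_cases hdis : Disjoint O X
  · right
    obtain ⟨f, u, hfO, hfX⟩ := geometric_hahn_banach_open hO hO' hX hdis
    have hf1 : (1 : (Fin m → ℝ) × ℝ) ∈ O := by simp [O]
    have hf0 : ∀ p : (Fin m → ℝ) × ℝ, 0 ≤ p.1 → 0 ≤ p.2 → f p ≤ 0 := by
      intro p h1 h2
      by_contra! hp
      have hlt := hfO 1 hf1
      have ht : 0 < (u - f 1) / f p := div_pos (by linarith) hp
      have := hfO (((u - f 1) / f p) • p + 1) (by
        refine ⟨fun i _ => ?_, ?_⟩
        · have := mul_nonneg ht.le (h1 i)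
          simp only [Prod.fst_add, Prod.smul_fst, Prod.fst_one, Pi.add_apply, Pi.smul_apply,
            Pi.one_apply, smul_eq_mul, Set.mem_Ioi] at this ⊢
          linarith
        · have := mul_nonneg ht.le h2
          simp only [Prod.snd_add, Prod.smul_snd, Prod.snd_one, smul_eq_mul, Set.mem_Ioi]
          linarith)
      rw [map_add, map_smul, smul_eq_mul, div_mul_cancel₀ _ hp.ne'] at this
      linarith
    have hu : 0 ≤ u := by
      by_contra! hu
      have hlt := hfO 1 hf1
      have ht : 0 < u / f 1 := div_pos_of_neg_of_neg hu (by linarith)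
      have := hfO ((u / f 1) • 1) (by simp [O, ht])
      rw [map_smul, smul_eq_mul, div_mul_cancel₀ _ (by linarith)] at this
      exact lt_irrefl _ this
    have hf : ∀ p : (Fin m → ℝ) × ℝ,
        f p = ∑ i, p.1 i * f (Pi.single i 1, 0) + p.2 * f (0, 1) := by
      intro p
      have : p = ∑ i, p.1 i • ((Pi.single i 1, 0) : (Fin m → ℝ) × ℝ) + p.2 • (0, 1) := by
        ext j
        · simp [Finset.sum_apply, Pi.single_apply, Prod.fst_sum]
        · simp [Prod.snd_sum]
      conv_lhs => rw [this]
      simp only [map_add, map_sum, map_smul, smul_eq_mul]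
    have hXf : ∀ (s : σ) (t : ℝ), 0 ≤ t → 0 ≤ f p₀ + t * f (c s, -r s) := by
      intro s t ht
      refine hu.trans (le_of_le_of_eq (hfX (p₀ + Λ (Finsupp.single s t))
        ⟨_, ⟨_, by simpa using ht, rfl⟩, rfl⟩) ?_)
      simp only [Λ, Finsupp.linearCombination_single, map_add, map_smul, smul_eq_mul]
    have hp₀ : 0 ≤ f p₀ := hu.trans (hfX p₀ ⟨0, ⟨0, by simp, by simp⟩, by simp⟩)
    refine ⟨fun i => -f (Pi.single i 1, 0), -f (0, 1), ?_, ?_, ?_, ?_, ?_⟩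
    · intro i
      exact neg_nonneg.2 (hf0 _ (by simp) le_rfl)
    · exact neg_nonneg.2 (hf0 _ le_rfl (by simp))
    · intro hκ hy
      have h0 : ∀ p, f p = 0 := by
        intro p
        rw [hf p, neg_eq_zero.1 hκ, mul_zero, add_zero]
        refine Finset.sum_eq_zero fun i _ => ?_
        rw [neg_eq_zero.1 (congrFun hy i), mul_zero]
      have h1 := hfO 1 hf1
      have h2 := hfX p₀ ⟨0, ⟨0, by simp, by simp⟩, by simp⟩
      rw [h0] at h1 h2
      linarith
    · intro s
      have h1 : 0 ≤ f (c s, -r s) := by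
        by_contra! h
        have := hXf s ((f p₀ + 1) / -f (c s, -r s)) (div_nonneg (by linarith) (by linarith))
        rw [div_mul_eq_mul_div, div_neg, mul_div_assoc, div_self h.ne, mul_one] at this
        linarith
      rw [hf] at h1
      simp only [mul_neg, Finset.sum_neg_distrib]
      linarith
    · rw [hf] at hp₀
      simp only [p₀, neg_mul, one_mul, Finset.sum_neg_distrib] at hp₀ ⊢
      linarith
  · left
    obtain ⟨_, ⟨h1, h2⟩, _, ⟨l, hl, rfl⟩, rfl⟩ := Set.not_disjoint_iff.1 hdis
    refine ⟨l, hl, fun i => ?_, ?_⟩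
    · have := h1 i (Set.mem_univ i)
      simp only [Λ, p₀, Finsupp.linearCombination_apply, Prod.fst_add, Pi.add_apply,
        Finsupp.sum, Prod.fst_sum, Finset.sum_apply, Prod.smul_fst, Pi.smul_apply, smul_eq_mul,
        Set.mem_Ioi] at this ⊢
      linarith
    · simp only [Λ, p₀, Finsupp.linearCombination_apply, Prod.snd_add, Finsupp.sum, Prod.snd_sum,
        Prod.smul_snd, smul_eq_mul, Set.mem_Ioi, mul_neg, Finset.sum_neg_distrib] at h2 ⊢
      linarith

/-- Rounding a fractional cover to an integral `q`-fold cover. -/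
lemma exists_family_of_cover {σ : Type*} {m : ℕ} (c : σ → Fin m → ℕ) (r : σ → ℕ) {v : ℝ}
    {l : σ →₀ ℝ} (hl : 0 ≤ l) (h1 : ∀ i, 1 < l.sum fun s t => t * c s i)
    (hv : (l.sum fun s t => t * r s) < v) :
    ∃ (N q : ℕ) (f : Fin N → σ), 0 < q ∧ (∀ i, q ≤ ∑ j, c (f j) i) ∧ (∑ j, r (f j) : ℕ) < q * v := by
  obtain ⟨q, hq⟩ := exists_nat_gt
    ((∑ s ∈ l.support, (r s : ℝ)) / (v - l.sum fun s t => t * r s))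
  rw [div_lt_iff₀ (by linarith)] at hq
  let ι := (s : l.support) × Fin ⌈(q : ℝ) * l s⌉₊
  have hsum : ∀ g : σ → ℕ, ∑ j : ι, g j.1 = ∑ s ∈ l.support, ⌈(q : ℝ) * l s⌉₊ * g s := by
    intro g
    rw [Fintype.sum_sigma, ← Finset.sum_coe_sort l.support]
    simp
  let e := Fintype.equivFin ι
  refine ⟨Fintype.card ι, q, fun j => (e.symm j).1, ?_, fun i => ?_, ?_⟩
  · rw [Nat.pos_iff_ne_zero]
    rintro rfl
    have : 0 ≤ ∑ s ∈ l.support, (r s : ℝ) := Finset.sum_nonneg fun _ _ => Nat.cast_nonneg _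
    simp at hq
    linarith
  · rw [e.symm.sum_comp fun j : ι => c j.1 i, hsum fun s => c s i]
    have h2 : (q : ℝ) * 1 ≤ q * l.sum fun s t => t * c s i :=
      mul_le_mul_of_nonneg_left (h1 i).le (Nat.cast_nonneg _)
    have h3 : q * (l.sum fun s t => t * c s i) ≤
        ∑ s ∈ l.support, (⌈(q : ℝ) * l s⌉₊ : ℝ) * c s i := by
      rw [Finsupp.sum, Finset.mul_sum]
      refine Finset.sum_le_sum fun s _ => ?_
      rw [← mul_assoc]
      exact mul_le_mul_of_nonneg_right (Nat.le_ceil _) (Nat.cast_nonneg _)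
    have h4 := h2.trans h3
    rw [mul_one] at h4
    exact_mod_cast h4
  · rw [e.symm.sum_comp fun j : ι => r j.1, hsum r]
    have h3 : ∑ s ∈ l.support, (⌈(q : ℝ) * l s⌉₊ : ℝ) * r s ≤
        q * (l.sum fun s t => t * r s) + ∑ s ∈ l.support, (r s : ℝ) := by
      rw [Finsupp.sum, Finset.mul_sum, ← Finset.sum_add_distrib]
      refine Finset.sum_le_sum fun s _ => ?_
      have h5 : (⌈(q : ℝ) * l s⌉₊ : ℝ) ≤ q * l s + 1 :=
        (Nat.ceil_lt_add_one (mul_nonneg (Nat.cast_nonneg _) (hl s))).le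
      have := mul_le_mul_of_nonneg_right h5 (Nat.cast_nonneg (r s))
      linarith
    push_cast
    linarith

end LinearProgramming

section Uncrossing

open Module

lemma sum_update_update {ι α : Type*} [Fintype ι] [DecidableEq ι] (f : ι → α) {j k : ι}
    (hjk : j ≠ k) (x y : α) (g : α → ℕ) :
    ∑ i, g (Function.update (Function.update f j x) k y i) + (g (f j) + g (f k)) =
      ∑ i, g (f i) + (g x + g y) := by
  have h : ∀ F : ι → ℕ, ∑ i, F i = F j + (F k + ∑ i ∈ (Finset.univ.erase j).erase k, F i) := by
    intro F
    rw [Finset.add_sum_erase _ _ (by simp [hjk.symm]), Finset.add_sum_erase _ _ (by simp)]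
  have h2 : ∑ i ∈ (Finset.univ.erase j).erase k,
      g (Function.update (Function.update f j x) k y i) =
      ∑ i ∈ (Finset.univ.erase j).erase k, g (f i) := by
    refine Finset.sum_congr rfl fun i hi => ?_
    simp only [Finset.mem_erase] at hi
    rw [Function.update_of_ne hi.1, Function.update_of_ne hi.2.1]
  rw [h fun i => g (f i), h fun i => g (Function.update (Function.update f j x) k y i), h2,
    Function.update_self, Function.update_of_ne hjk, Function.update_self]
  ring

variable {K V : Type*} [Field K] [AddCommGroup V] [Module K V] [FiniteDimensional K V]

lemma finrank_inf_add_finrank_inf_le (S T W : Submodule K V) :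
    finrank K ↥(S ⊓ W) + finrank K ↥(T ⊓ W) ≤
      finrank K ↥((S ⊔ T) ⊓ W) + finrank K ↥(S ⊓ T ⊓ W) := by
  rw [← Submodule.finrank_sup_add_finrank_inf_eq (S ⊓ W) (T ⊓ W)]
  refine add_le_add (Submodule.finrank_mono ?_) (Submodule.finrank_mono ?_)
  · exact sup_le (inf_le_inf_right _ le_sup_left) (inf_le_inf_right _ le_sup_right)
  · exact le_inf (inf_le_inf inf_le_left inf_le_left) (inf_le_left.trans inf_le_right)

/-- Any family of subspaces can be replaced by a chain with the same total dimension and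
no smaller total intersections with any given subspace. -/
lemma exists_pairwise_comparable {N : ℕ} (f : Fin N → Submodule K V) :
    ∃ g : Fin N → Submodule K V, (∀ W : Submodule K V,
      ∑ j, finrank K ↥(f j ⊓ W) ≤ ∑ j, finrank K ↥(g j ⊓ W)) ∧
      ∑ j, finrank K (g j) = ∑ j, finrank K (f j) ∧ ∀ j k, g j ≤ g k ∨ g k ≤ g j := by
  let μ : (Fin N → Submodule K V) → ℕ := fun g => ∑ j, finrank K (g j) ^ 2
  let G : Set (Fin N → Submodule K V) := {g | (∀ W : Submodule K V,
      ∑ j, finrank K ↥(f j ⊓ W) ≤ ∑ j, finrank K ↥(g j ⊓ W)) ∧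
      ∑ j, finrank K (g j) = ∑ j, finrank K (f j)}
  obtain ⟨g, ⟨hg1, hg2⟩, hmax⟩ :=
    (measure fun g => N * finrank K V ^ 2 - μ g).wf.has_min G ⟨f, fun _ => le_rfl, rfl⟩
  refine ⟨g, hg1, hg2, fun j k => ?_⟩
  by_contra! hjk
  have hne : j ≠ k := by rintro rfl; exact hjk.1 le_rfl
  let g' := Function.update (Function.update g j (g j ⊔ g k)) k (g j ⊓ g k)
  have hdim := Submodule.finrank_sup_add_finrank_inf_eq (g j) (g k)
  refine hmax g' ⟨fun W => (hg1 W).trans ?_, ?_⟩ ?_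
  · have h1 := sum_update_update g hne (g j ⊔ g k) (g j ⊓ g k) fun S => finrank K ↥(S ⊓ W)
    have h2 := finrank_inf_add_finrank_inf_le (g j) (g k) W
    simp only [g']
    omega
  · have h1 := sum_update_update g hne (g j ⊔ g k) (g j ⊓ g k) fun S => finrank K ↥S
    simp only [g']
    omega
  · have h1 := sum_update_update g hne (g j ⊔ g k) (g j ⊓ g k) fun S => finrank K ↥S ^ 2
    have h3 : finrank K (g j) < finrank K ↥(g j ⊔ g k) :=
      Submodule.finrank_lt_finrank_of_lt (left_lt_sup.2 hjk.2)
    have h4 : finrank K (g k) < finrank K ↥(g j ⊔ g k) :=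
      Submodule.finrank_lt_finrank_of_lt (right_lt_sup.2 hjk.1)
    have h5 : finrank K (g j) ^ 2 + finrank K (g k) ^ 2 <
        finrank K ↥(g j ⊔ g k) ^ 2 + finrank K ↥(g j ⊓ g k) ^ 2 := by
      zify at h3 h4 hdim ⊢
      nlinarith [mul_pos (sub_pos.2 h3) (sub_pos.2 h4)]
    have h6 : μ g < μ g' := by
      simp only [μ, g']
      omega
    have h7 : μ g' ≤ N * finrank K V ^ 2 := by
      refine (Finset.sum_le_card_nsmul _ _ (finrank K V ^ 2) fun i _ => ?_).trans (by simp)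
      exact Nat.pow_le_pow_left (Submodule.finrank_le _) 2
    show N * finrank K V ^ 2 - μ g' < N * finrank K V ^ 2 - μ g
    omega

/-- Sorting a finite chain of subspaces into a decreasing sequence. -/
lemma exists_antitone_of_pairwise_comparable {N : ℕ} (g : Fin N → Submodule K V)
    (hg : ∀ j k, g j ≤ g k ∨ g k ≤ g j) :
    ∃ F : ℕ → Submodule K V, Antitone F ∧ (∀ j, N ≤ j → F j = ⊥) ∧
      ∀ h : Submodule K V → ℕ, ∑ j ∈ Finset.range N, h (F j) = ∑ j, h (g j) := by
  let D : Fin N → ℕᵒᵈ := fun j => OrderDual.toDual (finrank K (g j))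
  let τ := Tuple.sort D
  have hτ : Monotone (D ∘ τ) := Tuple.monotone_sort D
  refine ⟨fun j => if h : j < N then g (τ ⟨j, h⟩) else ⊥, ?_, fun j hj => ?_, fun h => ?_⟩
  · intro j k hjk
    dsimp only
    split_ifs with hk hj hj
    · have h1 : finrank K (g (τ ⟨k, hk⟩)) ≤ finrank K (g (τ ⟨j, hj⟩)) :=
        OrderDual.toDual_le_toDual.1 (hτ (show (⟨j, hj⟩ : Fin N) ≤ ⟨k, hk⟩ from hjk))
      rcases hg (τ ⟨k, hk⟩) (τ ⟨j, hj⟩) with h2 | h2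
      · exact h2
      · exact (Submodule.eq_of_le_of_finrank_le h2 h1).ge
    · omega
    · exact bot_le
    · exact le_rfl
  · simp [hj]
  · rw [Finset.sum_range]
    simp only [Fin.is_lt, dite_true, Fin.eta]
    exact Equiv.sum_comp τ fun j => h (g j)

end Uncrossing

section MinMax

open Module

lemma two_le_add_of_antitone {c : ℕ → ℕ} (hc : Antitone c) (h2 : ∀ j, c j ≤ 2) {N q j k : ℕ}
    (hq : q ≤ ∑ x ∈ Finset.range N, c x) (hjk : j ≤ k) (hsum : j + k + 1 = q) :
    2 ≤ c j + c k := by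
  by_contra! hlt
  have hk0 : c k = 0 := by have := hc hjk; omega
  have hle : ∀ x, c x ≤ (if x < j then 1 else 0) + (if x < k then 1 else 0) := by
    intro x
    have h1 := h2 x
    rcases lt_or_ge x j with hx | hx
    · simp [hx, hx.trans_le hjk, h1]
    · have h3 := hc hx
      rcases lt_or_ge x k with hx' | hx'
      · simp [hx', not_lt.2 hx]; omega
      · have h4 := hc hx'
        omega
  have hcount : ∀ t, ∑ x ∈ Finset.range N, (if x < t then 1 else 0) ≤ t := by
    intro t
    rw [← Finset.sum_filter, Finset.sum_const, smul_eq_mul, mul_one]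
    refine (Finset.card_le_card (t := Finset.range t) fun x hx => ?_).trans (by simp)
    simpa using (Finset.mem_filter.1 hx).2
  have := Finset.sum_le_sum fun x (_ : x ∈ Finset.range N) => hle x
  rw [Finset.sum_add_distrib] at this
  have h5 := hcount j
  have h6 := hcount k
  omega

lemma exists_add_lt_of_sum_lt {N q : ℕ} (r : ℕ → ℕ) (hr : ∀ j, N ≤ j → r j = 0) {v : ℝ}
    (hv : (∑ j ∈ Finset.range N, r j : ℕ) < q * v) :
    ∃ j k, j ≤ k ∧ j + k + 1 = q ∧ (r j + r k : ℝ) < 2 * v := by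
  obtain ⟨j, hj, hjv⟩ : ∃ j < q, (r j + r (q - 1 - j) : ℝ) < 2 * v := by
    by_contra! hcon
    have h1 := Finset.sum_le_sum fun j hj => hcon j (Finset.mem_range.1 hj)
    rw [Finset.sum_add_distrib, Finset.sum_range_reflect (fun j => (r j : ℝ)), Finset.sum_const,
      Finset.card_range, nsmul_eq_mul] at h1
    have h2 : ∑ j ∈ Finset.range q, r j ≤ ∑ j ∈ Finset.range N, r j := by
      refine Finset.sum_le_sum_of_ne_zero fun j _ hj => ?_
      by_contra h
      exact hj (hr j (by simpa using h))
    have h3 : (∑ j ∈ Finset.range q, (r j : ℝ)) ≤ (∑ j ∈ Finset.range N, r j : ℕ) := by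
      exact_mod_cast h2
    linarith
  rcases le_total j (q - 1 - j) with h | h
  · exact ⟨j, q - 1 - j, h, by omega, hjv⟩
  · exact ⟨q - 1 - j, j, h, by omega, by linarith⟩

variable {K : Type*} [Field K] {n m : ℕ} {a b : Fin m → Fin n → K}

lemma IsFracMatching.two_mul_sum_le_card (hab : ∀ i, LinearIndependent K ![a i, b i])
    {y : Fin m → ℝ} (hy : IsFracMatching a b y) : 2 * ∑ i, y i ≤ n := by
  have h := hy.2 ⊤
  rw [finrank_top, finrank_fin_fun] at h
  rw [Finset.mul_sum]
  refine le_of_eq_of_le (Finset.sum_congr rfl fun i _ => ?_) h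
  rw [finrank_inf_line_eq_two (hab i) Submodule.mem_top Submodule.mem_top]
  norm_num

lemma rank_blowup_le_of_forall_sum_lt (hab : ∀ i, LinearIndependent K ![a i, b i]) (d : ℕ) {v : ℝ}
    (hv : ∀ y, IsFracMatching a b y → ∑ i, y i < v) :
    ((blowup a b d).rank : ℝ) ≤ 2 * d * v := by
  rcases exists_cover_or_exists_functional
    (fun (S : Submodule K (Fin n → K)) i => (finrank K ↥(S ⊓ line (a i) (b i)) : ℝ))
    (fun S => (finrank K S : ℝ)) v with ⟨l, hl, h1, h2⟩ | ⟨y, κ, hy, hκ, hκy, hS, hsum⟩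
  · obtain ⟨N, q, f, -, hf1, hf2⟩ := exists_family_of_cover
      (fun (S : Submodule K (Fin n → K)) i => finrank K ↥(S ⊓ line (a i) (b i)))
      (fun S => finrank K S) hl h1 h2
    obtain ⟨g, hg1, hg2, hg3⟩ := exists_pairwise_comparable f
    obtain ⟨F, hF, hF0, hFsum⟩ := exists_antitone_of_pairwise_comparable g hg3
    obtain ⟨j, k, hjk, hq, hjkv⟩ := exists_add_lt_of_sum_lt (q := q) (v := v)
      (fun j => finrank K (F j)) (fun j hj => by rw [hF0 j hj, finrank_bot]) (by
        rw [hFsum fun S => finrank K S, hg2]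
        exact hf2)
    have hrank := rank_blowup_le_of_finrank_inf_line hab d (hF hjk) fun i =>
      two_le_add_of_antitone (c := fun j => finrank K ↥(F j ⊓ line (a i) (b i))) (N := N)
        (fun j k h => Submodule.finrank_mono (inf_le_inf_right _ (hF h)))
        (fun j => finrank_inf_line_le (hab i) _) (by
          rw [hFsum fun S => finrank K ↥(S ⊓ line (a i) (b i))]
          exact (hf1 i).trans (hg1 _)) hjk hq
    calc ((blowup a b d).rank : ℝ) ≤ d * (finrank K (F j) + finrank K (F k)) := by
          exact_mod_cast hrank
      _ ≤ d * (2 * v) := mul_le_mul_of_nonneg_left hjkv.le (Nat.cast_nonneg _)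
      _ = 2 * d * v := by ring
  · exfalso
    rcases hκ.eq_or_lt with rfl | hκ
    · refine hκy rfl (funext fun i => ?_)
      have h := hS ⊤
      rw [zero_mul] at h
      have hi := Finset.single_le_sum (f := fun i =>
        (finrank K ↥((⊤ : Submodule K (Fin n → K)) ⊓ line (a i) (b i)) : ℝ) * y i)
        (fun i _ => mul_nonneg (Nat.cast_nonneg _) (hy i)) (Finset.mem_univ i)
      have h2 := hi.trans h
      simp only [finrank_inf_line_eq_two (hab i) Submodule.mem_top Submodule.mem_top] at h2
      have := hy i
      simp only [Pi.zero_apply] at this ⊢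
      push_cast at h2
      linarith
    · have h := hv (fun i => y i / κ) ⟨fun i => div_nonneg (hy i) hκ.le, fun S => ?_⟩
      · rw [← Finset.sum_div, div_lt_iff₀ hκ] at h
        linarith
      · simp only [← mul_div_assoc]
        rw [← Finset.sum_div, div_le_iff₀ hκ, mul_comm _ κ]
        exact hS S

lemma two_le_rank_blowup_one {a b : Fin m → Fin 2 → K} (i : Fin m)
    (h : LinearIndependent K ![a i, b i]) : 2 ≤ (blowup a b 1).rank := by
  have h1 := rank_eval_le_rank_blowup a b (RingHom.id K) (d := 1) (Pi.single i 1)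
  refine le_trans ?_ ((rank_submatrix_le _ (fun p => (0, p)) fun p => (0, p)).trans h1)
  have h2 : ((of fun u v : Fin 1 × Fin 2 => ∑ j, (Pi.single i 1 : Fin m → Matrix (Fin 1) (Fin 1) K)
      j u.1 v.1 * RingHom.id K (wedge (a j) (b j) u.2 v.2)).submatrix (fun p => (0, p))
        fun p => (0, p)) = wedge (a i) (b i) := by
    ext p q
    rw [submatrix_apply, of_apply, Finset.sum_eq_single i]
    · simp
    · intro j _ hj
      simp [Pi.single_eq_of_ne hj]
    · simp
  rw [h2, rank_of_det_ne_zero, Fintype.card_fin]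
  have h3 : IsUnit (of ![a i, b i]) := linearIndependent_rows_iff_isUnit.1 h
  rw [isUnit_iff_isUnit_det, det_fin_two] at h3
  have h4 := h3.ne_zero
  rw [det_fin_two]
  simp only [of_apply, cons_val_zero, cons_val_one] at h4
  simp only [wedge, Matrix.sub_apply, vecMulVec_apply]
  intro h5
  exact h4 (pow_eq_zero_iff two_ne_zero |>.1 (by linear_combination h5))

lemma IsFracMatching.two_mul_d_mul_sum_le_rank_blowup (hm : 0 < m)
    (hab : ∀ i, LinearIndependent K ![a i, b i]) {d : ℕ} (hd1 : 1 ≤ d) (hd : n - 1 ≤ d)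
    {y : Fin m → ℝ} (hy : IsFracMatching a b y) :
    2 * d * ∑ i, y i ≤ ((blowup a b d).rank : ℝ) := by
  rcases hd1.eq_or_lt with rfl | hd2
  · have hn2 : 2 ≤ n := by
      have := Submodule.finrank_le (line (a ⟨0, hm⟩) (b ⟨0, hm⟩))
      rwa [finrank_line (hab _), finrank_fin_fun] at this
    obtain rfl : n = 2 := by omega
    have h1 := hy.two_mul_sum_le_card hab
    have h2 : (2 : ℝ) ≤ (blowup a b 1).rank := by
      exact_mod_cast two_le_rank_blowup_one ⟨0, hm⟩ (hab _)
    push_cast at h1 ⊢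
    linarith
  · obtain ⟨S, T, hST, hle⟩ := exists_coveringPair_le_rank_blowup a b hd2
    have h1 := hy.two_mul_sum_le hab hST
    calc 2 * d * ∑ i, y i = d * (2 * ∑ i, y i) := by ring
      _ ≤ d * (finrank K S + finrank K T) := mul_le_mul_of_nonneg_left h1 (Nat.cast_nonneg _)
      _ ≤ _ := by exact_mod_cast hle

end MinMax

/-- For `d ≥ n − 1`, the rank of the `d`-th blow-up of the matrix representation equals
`2d` times the maximum cardinality of a fractional matroid matching. -/
theorem rank_blowup_eq_two_d_mul_max_fracMatching
    {K : Type*} [Field K] {n m : ℕ} (hn : 0 < n) (hm : 0 < m)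
    (a b : Fin m → Fin n → K) (hab : ∀ i, LinearIndependent K ![a i, b i])
    (d : ℕ) (hd1 : 1 ≤ d) (hd : n - 1 ≤ d) :
    ((blowup a b d).rank : ℝ) =
      2 * d * sSup {r : ℝ | ∃ y : Fin m → ℝ, IsFracMatching a b y ∧ r = ∑ i, y i} := by
  set Y := {r : ℝ | ∃ y : Fin m → ℝ, IsFracMatching a b y ∧ r = ∑ i, y i}
  have hne : Y.Nonempty :=
    ⟨0, 0, ⟨fun _ => le_rfl, fun S => by simp⟩, by simp⟩
  have hbdd : BddAbove Y := by
    refine ⟨n / 2, ?_⟩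
    rintro _ ⟨y, hy, rfl⟩
    have := hy.two_mul_sum_le_card hab
    linarith
  have hd0 : (0 : ℝ) < 2 * d := by
    have : (0 : ℝ) < d := by exact_mod_cast hd1
    linarith
  apply le_antisymm
  · rw [← div_le_iff₀' hd0]
    refine le_of_forall_gt_imp_ge_of_dense fun v hv => ?_
    rw [div_le_iff₀' hd0]
    exact rank_blowup_le_of_forall_sum_lt hab d fun y hy =>
      (le_csSup hbdd ⟨y, hy, rfl⟩).trans_lt hv
  · rw [← le_div_iff₀' hd0]
    refine csSup_le hne ?_
    rintro _ ⟨y, hy, rfl⟩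
    rw [le_div_iff₀' hd0]
    exact hy.two_mul_d_mul_sum_le_rank_blowup hm hab hd1 hd
end
end

section
/- Let A = Σ_{i=1}^m x_i A_i be an n×n linear matrix over a field K in which every coefficient matrix A_i is skew-symmetric (with zero diagonal). Then the minimum of 2n − s − t over all s, t ∈ {0,…,n} for which there exist P, Q ∈ GL_n(K) such that (P A_i Q)_{p,q} = 0 for all i ∈ {1,…,m}, all rows p > n − s, and all columns q ≤ t, is equal to the minimum of 2n − s − t over all s, t with 0 ≤ t ≤ s ≤ n for which there exists a single P ∈ GL_n(K) such that (P A_i Pᵀ)_{p,q} = 0 for all i ∈ {1,…,m} whenever p > n − s and q > n − t. (That is, for skew-symmetric linear matrices the Fortin–Rézaiguia minimum for the non-commutative rank is attained by simultaneous row and column operations P A Pᵀ.) -/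
open Matrix

noncomputable section

open Module

/-- A family of `k` subspaces whose `i`-th member has dimension greater than `i` admits a
linearly independent system of representatives. -/
theorem exists_linearIndependent_mem_of_lt_finrank {K V : Type*} [Field K] [AddCommGroup V]
    [Module K V] [FiniteDimensional K V] {k : ℕ} (W : Fin k → Submodule K V)
    (hW : ∀ i : Fin k, (i : ℕ) < finrank K (W i)) :
    ∃ f : Fin k → V, LinearIndependent K f ∧ ∀ i, f i ∈ W i := by
  induction k with
  | zero => exact ⟨Fin.elim0, linearIndependent_empty_type, fun i => i.elim0⟩
  | succ k ih =>
    obtain ⟨f, hf, hfW⟩ := ih (fun i => W i.castSucc) fun i => by simpa using hW i.castSucc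
    obtain ⟨x, hxW, hx⟩ : ∃ x ∈ W (Fin.last k), x ∉ Submodule.span K (Set.range f) := by
      by_contra! h
      have h₁ := Submodule.finrank_mono (show W (Fin.last k) ≤ Submodule.span K (Set.range f) from h)
      rw [finrank_span_eq_card hf, Fintype.card_fin] at h₁
      exact absurd (hW (Fin.last k)) (by simpa using h₁)
    refine ⟨Fin.snoc f x, linearIndependent_finSnoc.2 ⟨hf, hx⟩, fun i => ?_⟩
    refine Fin.lastCases ?_ (fun j => ?_) i
    · simpa using hxW
    · simpa using hfW j

/-- An orthogonality relation with respect to a matrix passes to spans. -/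
theorem dotProduct_mulVec_eq_zero_of_mem_span {K ι : Type*} [Field K] [Fintype ι]
    (M : Matrix ι ι K) {S T : Set (ι → K)} (h : ∀ u ∈ S, ∀ v ∈ T, u ⬝ᵥ M *ᵥ v = 0)
    {u v : ι → K} (hu : u ∈ Submodule.span K S) (hv : v ∈ Submodule.span K T) :
    u ⬝ᵥ M *ᵥ v = 0 := by
  induction hu using Submodule.span_induction with
  | mem u hu =>
    induction hv using Submodule.span_induction with
    | mem v hv => exact h u hu v hv
    | zero => simp
    | add x y _ _ hx hy => simp [mulVec_add, hx, hy]
    | smul c x _ hx => simp [mulVec_smul, hx]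
  | zero => simp
  | add x y _ _ hx hy => simp [add_dotProduct, hx, hy]
  | smul c x _ hx => simp [hx]

/-- A skew-symmetric matrix induces an antisymmetric bilinear form. -/
theorem dotProduct_mulVec_swap_of_transpose_eq_neg {K ι : Type*} [Field K] [Fintype ι]
    {M : Matrix ι ι K} (hM : Mᵀ = -M) (u v : ι → K) : u ⬝ᵥ M *ᵥ v = -(v ⬝ᵥ M *ᵥ u) := by
  rw [dotProduct_mulVec, ← mulVec_transpose, hM, neg_mulVec, neg_dotProduct, dotProduct_comm]

theorem mul_mul_apply_eq_row_dotProduct_mulVec_col {K ι : Type*} [Field K] [Fintype ι]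
    (P M Q : Matrix ι ι K) (p q : ι) : (P * M * Q) p q = P.row p ⬝ᵥ M *ᵥ Q.col q :=
  mul_mul_apply P M Q p q

/-- Subspaces `V ≤ U` that are orthogonal for each `M i` give a congruence producing a common
bottom-right zero block of size `finrank U × finrank V`. -/
theorem exists_isUnit_zero_block_of_orthogonal {K ι : Type*} [Field K] {n : ℕ}
    (M : ι → Matrix (Fin n) (Fin n) K) {U V : Submodule K (Fin n → K)} (hVU : V ≤ U)
    (h : ∀ i, ∀ u ∈ U, ∀ v ∈ V, u ⬝ᵥ M i *ᵥ v = 0) :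
    ∃ P : Matrix (Fin n) (Fin n) K, IsUnit P ∧ ∀ i, ∀ p q : Fin n,
      n - finrank K U ≤ (p : ℕ) → n - finrank K V ≤ (q : ℕ) → (P * M i * Pᵀ) p q = 0 := by
  classical
  obtain ⟨f, hf, hfW⟩ := exists_linearIndependent_mem_of_lt_finrank (K := K) (k := n)
    (fun i => if (i : ℕ) < finrank K V then V else if (i : ℕ) < finrank K U then U else ⊤)
    (fun i => by
      by_cases hV : (i : ℕ) < finrank K V
      · rwa [if_pos hV]
      · by_cases hU : (i : ℕ) < finrank K U
        · rwa [if_neg hV, if_pos hU]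
        · rw [if_neg hV, if_neg hU, finrank_top, finrank_fin_fun]
          exact i.isLt)
  refine ⟨of fun p => f p.rev, ?_, fun i p q hp hq => ?_⟩
  · rw [← linearIndependent_rows_iff_isUnit]
    exact hf.comp _ Fin.rev_injective
  · rw [mul_mul_apply_eq_row_dotProduct_mulVec_col]
    refine h i _ ?_ _ ?_
    · have hlt : (p.rev : ℕ) < finrank K U := by rw [Fin.val_rev]; omega
      have := hfW p.rev
      split_ifs at this
      · exact hVU this
      · exact this
    · have hlt : (q.rev : ℕ) < finrank K V := by rw [Fin.val_rev]; omega
      have := hfW q.rev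
      rwa [if_pos hlt] at this

/-- Any set of rows of an invertible matrix spans a subspace of dimension its cardinality. -/
theorem finrank_span_rows_of_isUnit {K ι : Type*} [Field K] [Fintype ι] [DecidableEq ι]
    {P : Matrix ι ι K} (hP : IsUnit P) (S : Finset ι) :
    finrank K (Submodule.span K (P.row '' S)) = S.card := by
  have hli := (linearIndependent_rows_iff_isUnit.2 hP).comp ((↑) : S → ι) Subtype.val_injective
  have := finrank_span_eq_card hli
  rw [Set.range_comp, Subtype.range_coe_subtype, Finset.setOfPred_mem] at this
  simpa using this

/-- For a linear matrix `A = ∑ᵢ xᵢ Aᵢ` with skew-symmetric coefficients, the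
Fortin–Rézaiguia minimum `2n − s − t` over pairs `(P, Q)` of invertible matrices producing
a common bottom-left `s × t` zero block in all `P Aᵢ Q` is attained by simultaneous row and
column operations `P Aᵢ Pᵀ` producing a common bottom-right zero block with `t ≤ s`. -/
theorem skewSymmetric_ncrank_min_symmetric_transform
    {K : Type*} [Field K] {n m : ℕ} (hn : 0 < n)
    (A : Fin m → Matrix (Fin n) (Fin n) K)
    (hskew : ∀ i, (A i)ᵀ = -(A i)) (hdiag : ∀ i p, A i p p = 0) :
    sInf {r : ℕ | ∃ s t : ℕ, s ≤ n ∧ t ≤ n ∧ r = 2 * n - s - t ∧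
        ∃ P Q : Matrix (Fin n) (Fin n) K, IsUnit P ∧ IsUnit Q ∧
          ∀ i : Fin m, ∀ p q : Fin n, n - s ≤ (p : ℕ) → (q : ℕ) < t →
            (P * A i * Q) p q = 0} =
    sInf {r : ℕ | ∃ s t : ℕ, t ≤ s ∧ s ≤ n ∧ r = 2 * n - s - t ∧
        ∃ P : Matrix (Fin n) (Fin n) K, IsUnit P ∧
          ∀ i : Fin m, ∀ p q : Fin n, n - s ≤ (p : ℕ) → n - t ≤ (q : ℕ) →
            (P * A i * Pᵀ) p q = 0} := by
  congr 1
  ext r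
  constructor
  · rintro ⟨s, t, hs, ht, rfl, P, Q, hP, hQ, h⟩
    have hcs : (Finset.univ.filter fun p : Fin n => n - s ≤ (p : ℕ)).card = s := by
      have := Finset.card_filter_add_card_filter_not (s := (Finset.univ : Finset (Fin n)))
        (fun p : Fin n => (p : ℕ) < n - s)
      simp only [not_lt, Fin.card_filter_val_lt, Finset.card_univ, Fintype.card_fin] at this
      omega
    have hct : (Finset.univ.filter fun q : Fin n => (q : ℕ) < t).card = t := by
      rw [Fin.card_filter_val_lt, min_eq_right ht]
    have hU := finrank_span_rows_of_isUnit hP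
      (Finset.univ.filter fun p : Fin n => n - s ≤ (p : ℕ))
    have hV := finrank_span_rows_of_isUnit ((isUnit_transpose Q).2 hQ)
      (Finset.univ.filter fun q : Fin n => (q : ℕ) < t)
    rw [hcs] at hU
    rw [hct] at hV
    set U := Submodule.span K
      (P.row '' (Finset.univ.filter fun p : Fin n => n - s ≤ (p : ℕ) : Finset (Fin n)))
    set V := Submodule.span K
      (Qᵀ.row '' (Finset.univ.filter fun q : Fin n => (q : ℕ) < t : Finset (Fin n)))
    have hUV : ∀ i, ∀ u ∈ U, ∀ v ∈ V, u ⬝ᵥ A i *ᵥ v = 0 := by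
      intro i u hu v hv
      refine dotProduct_mulVec_eq_zero_of_mem_span (A i) ?_ hu hv
      rintro _ ⟨p, hp, rfl⟩ _ ⟨q, hq, rfl⟩
      refine (mul_mul_apply_eq_row_dotProduct_mulVec_col P (A i) Q p q).symm.trans ?_
      exact h i p q (by simpa using hp) (by simpa using hq)
    have hdim := Submodule.finrank_sup_add_finrank_inf_eq U V
    have hle : finrank K ↥(U ⊓ V) ≤ finrank K ↥(U ⊔ V) :=
      Submodule.finrank_mono (inf_le_left.trans le_sup_left)
    have hn' : finrank K ↥(U ⊔ V) ≤ n := by simpa using Submodule.finrank_le (U ⊔ V)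
    refine ⟨finrank K ↥(U ⊔ V), finrank K ↥(U ⊓ V), hle, hn', by omega, ?_⟩
    refine exists_isUnit_zero_block_of_orthogonal A (inf_le_left.trans le_sup_left) ?_
    intro i w hw v hv
    obtain ⟨x, hx, y, hy, rfl⟩ := Submodule.mem_sup.1 hw
    rw [add_dotProduct, hUV i x hx v hv.2,
      dotProduct_mulVec_swap_of_transpose_eq_neg (hskew i) y v, hUV i v hv.1 y hy, neg_zero,
      add_zero]
  · rintro ⟨s, t, hts, hs, rfl, P, hP, h⟩
    refine ⟨s, t, hs, hts.trans hs, rfl, P, (P.submatrix Fin.rev id)ᵀ, hP, ?_, ?_⟩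
    · rw [isUnit_transpose]
      exact (isUnit_submatrix_equiv (e₁ := Fin.revPerm) (e₂ := Equiv.refl _)).2 hP
    · intro i p q hp hq
      rw [mul_mul_apply_eq_row_dotProduct_mulVec_col]
      have := h i p q.rev hp (by rw [Fin.val_rev]; omega)
      rwa [mul_mul_apply_eq_row_dotProduct_mulVec_col] at this
end
end
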